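/- arXiv:2507.11828 — 2 statements merged into one kernel-verified Lean document; each statement's English description precedes it below -/
import Mathlib

section
/- Let q be an odd prime, k ≥ 2, and p_1, …, p_{k+2} distinct primes. For s ∈ Q_0 let q − s denote q minus the representative of s in {0, …, q−1}. Define S as the union of: A = { p_2 · p_3^{q−s} · ∏_{i=4}^{k+2} p_i^{α_i} : s ∈ Q_0, α_i ∈ {0, …, q−1} }; B = { p_1^{q−s} · p_3 · ∏_{i=4}^{k+2} p_i^{α_i} : s ∈ Q_0, α_i ∈ {0, …, q−1} }; C = { p_1 · p_2^{q−s} · ∏_{i=4}^{k+2} p_i^{α_i} : s ∈ Q_0, α_i ∈ {0, …, q−1} }; and, for each j = 4, …, k+2, D_j = { p_j · ∏_{i=j+1}^{k+2} p_i^{α_i} : α_i ∈ {0, …, q−1} } (so D_{k+2} = {p_{k+2}}). Then S contains no perfect q-th power, S belongs to 𝒯_{k,q}, S is minimal in 𝒯_{k,q} (no proper subset of S belongs to 𝒯_{k,q}), and |S| = (q^{k+1} − 1)/(q − 1) + q^{k−1}·(q + 1)/2. -/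
open Finset

/-- `S ∈ 𝒯_{k,q}`: there is a positive integer `Δ` such that for every natural number `N`
with `Ω(N) ≤ k` and `gcd(N, Δ) = 1`, some `s ∈ S` is a `q`-th power modulo `N`. -/
def MemT (q k : ℕ) (S : Set ℤ) : Prop :=
  ∃ Δ : ℕ, 0 < Δ ∧ ∀ N : ℕ, 0 < N → N.primeFactorsList.length ≤ k → Nat.Coprime N Δ →
    ∃ s ∈ S, ∃ x : ℤ, (N : ℤ) ∣ x ^ q - s

/-- `s` is a perfect `q`-th power of an integer. -/
def IsPerfectPow (q : ℕ) (s : ℤ) : Prop := ∃ r : ℤ, r ^ q = s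

/-- The finite set of primes dividing `∏_{s ∈ S} rad_q(|s|)`, i.e. the primes `p` such that
`q ∤ v_p(|s|)` for some `s ∈ S`. -/
def qPrimes (q : ℕ) (S : Finset ℤ) : Finset ℕ :=
  S.sup fun s => s.natAbs.primeFactors.filter fun p => ¬ q ∣ s.natAbs.factorization p

/-- The vector `(v_{p_1}(|u|) mod q, …, v_{p_n}(|u|) mod q)` where `p_1 < … < p_n`
is the increasing enumeration of the finite set of primes `P`. -/
def vecOf (q : ℕ) (P : Finset ℕ) (u : ℤ) : Fin P.card → ZMod q :=
  fun i => ((u.natAbs.factorization (P.orderIsoOfFin rfl i).1 : ℕ) : ZMod q)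

/-- The projective point `⟨v⟩` of `PG(F_q^n)` spanned by a vector `v`. -/
def projPoint {q n : ℕ} (v : Fin n → ZMod q) : Submodule (ZMod q) (Fin n → ZMod q) :=
  Submodule.span (ZMod q) {v}

/-- The set of projective points associated with `S` in `PG(F_q^n)`,
`n` being the number of distinct primes dividing `∏_{s ∈ S} rad_q(|s|)`. -/
def assocPoints (q : ℕ) (S : Finset ℤ) :
    Set (Submodule (ZMod q) (Fin (qPrimes q S).card → ZMod q)) :=
  {P | ∃ s ∈ S, P = projPoint (vecOf q (qPrimes q S) s)}

/-- `B` is a `k`-blocking set of `PG(F_q^n)`: every subspace of codimension `k`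
contains a nonzero vector spanning a point of `B`. -/
def IsBlockingSet (q n k : ℕ) (B : Set (Submodule (ZMod q) (Fin n → ZMod q))) : Prop :=
  ∀ W : Submodule (ZMod q) (Fin n → ZMod q), Module.finrank (ZMod q) W = n - k →
    ∃ v ∈ W, v ≠ 0 ∧ projPoint v ∈ B

/-- `B` is (the point set of) a `k`-space of `PG(F_q^n)`. -/
def IsKSpace (q n k : ℕ) (B : Set (Submodule (ZMod q) (Fin n → ZMod q))) : Prop :=
  ∃ W : Submodule (ZMod q) (Fin n → ZMod q), Module.finrank (ZMod q) W = k + 1 ∧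
    B = {P | ∃ v ∈ W, v ≠ 0 ∧ P = projPoint v}

/-- `S` and `T` are geometrically `q`-equivalent: some element of `PGL(n, q)` maps the point set
associated with `S` onto the point set associated with `T`, where the points are computed with
respect to all the primes dividing `(∏_{s ∈ S} rad_q(|s|)) ⬝ (∏_{t ∈ T} rad_q(|t|))`. -/
def GeomEquiv (q : ℕ) (S T : Finset ℤ) : Prop :=
  ∃ Ψ : (Fin (qPrimes q (S ∪ T)).card → ZMod q) ≃ₗ[ZMod q]
        (Fin (qPrimes q (S ∪ T)).card → ZMod q),
    (Submodule.map Ψ.toLinearMap) ''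
        {P | ∃ s ∈ S, P = projPoint (vecOf q (qPrimes q (S ∪ T)) s)} =
      {P | ∃ t ∈ T, P = projPoint (vecOf q (qPrimes q (S ∪ T)) t)}

/-- The set of squares of `F_qˣ` together with `0`. -/
def Q0 (q : ℕ) : Set (ZMod q) := {x | (∃ a : ZMod q, a ≠ 0 ∧ a ^ 2 = x) ∨ x = 0}
/-- The minimal set of second smallest cardinality in `𝒯_{k,q}`, built on `k + 2` distinct
primes `p_1, …, p_{k+2}` (here `0`-indexed as `p 0, …, p (k+1)`):
`A ∪ B ∪ C ∪ D_4 ∪ ⋯ ∪ D_{k+2}` where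
`A = {p_2 p_3^{q-s} ∏_{i=4}^{k+2} p_i^{α_i}}`, `B = {p_1^{q-s} p_3 ∏_{i=4}^{k+2} p_i^{α_i}}`,
`C = {p_1 p_2^{q-s} ∏_{i=4}^{k+2} p_i^{α_i}}` (`s ∈ Q_0`, `α_i ∈ {0,…,q-1}`), and
`D_j = {p_j ∏_{i=j+1}^{k+2} p_i^{α_i}}` for `j = 4, …, k+2`. -/
def secondSet (q k : ℕ) (p : Fin (k + 2) → ℕ) : Set ℤ :=
  {m | ∃ s ∈ Q0 q, ∃ α : Fin (k + 2) → ℕ, (∀ i, α i ≤ q - 1) ∧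
      m = (p 1 : ℤ) * (p 2 : ℤ) ^ (q - ZMod.val s) *
        ∏ i ∈ Finset.univ.filter (fun i : Fin (k + 2) => 3 ≤ (i : ℕ)), (p i : ℤ) ^ α i} ∪
  {m | ∃ s ∈ Q0 q, ∃ α : Fin (k + 2) → ℕ, (∀ i, α i ≤ q - 1) ∧
      m = (p 0 : ℤ) ^ (q - ZMod.val s) * (p 2 : ℤ) *
        ∏ i ∈ Finset.univ.filter (fun i : Fin (k + 2) => 3 ≤ (i : ℕ)), (p i : ℤ) ^ α i} ∪
  {m | ∃ s ∈ Q0 q, ∃ α : Fin (k + 2) → ℕ, (∀ i, α i ≤ q - 1) ∧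
      m = (p 0 : ℤ) * (p 1 : ℤ) ^ (q - ZMod.val s) *
        ∏ i ∈ Finset.univ.filter (fun i : Fin (k + 2) => 3 ≤ (i : ℕ)), (p i : ℤ) ^ α i} ∪
  {m | ∃ j : Fin (k + 2), 3 ≤ (j : ℕ) ∧ ∃ α : Fin (k + 2) → ℕ, (∀ i, α i ≤ q - 1) ∧
      m = (p j : ℤ) *
        ∏ i ∈ Finset.univ.filter (fun i : Fin (k + 2) => (j : ℕ) < (i : ℕ)), (p i : ℤ) ^ α i}



section Analytic
open NumberField Filter Topology

theorem aux_zb (K : Type*) [Field K] [NumberField K] :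
    ∃ c : ℝ, 0 < c ∧ ∃ C : ℝ, 0 < C ∧ ∃ ε : ℝ, 0 < ε ∧ ∀ s : ℝ, 1 < s → s < 1 + ε →
      (∀ F : Finset (Ideal (𝓞 K)), (∀ I ∈ F, I ≠ ⊥) →
        ∑ I ∈ F, (Ideal.absNorm I : ℝ) ^ (-s) ≤ C / (s - 1)) ∧
      ∃ F : Finset (Ideal (𝓞 K)), (∀ I ∈ F, I ≠ ⊥) ∧
        c / (s - 1) ≤ ∑ I ∈ F, (Ideal.absNorm I : ℝ) ^ (-s) := by
  classical
  set r := dedekindZeta_residue K with hr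
  have hr0 : 0 < r := dedekindZeta_residue_pos K
  have ht := (tendsto_sub_one_mul_dedekindZeta_nhdsGT K).norm
  have hnr : ‖((dedekindZeta_residue K : ℝ) : ℂ)‖ = r := by
    rw [Complex.norm_real, Real.norm_of_nonneg hr0.le]
  rw [hnr] at ht
  have h1 := ht.eventually (Ioo_mem_nhds (show r / 2 < r by linarith) (show r < 2 * r by linarith))
  rw [eventually_nhdsWithin_iff, Metric.eventually_nhds_iff] at h1
  obtain ⟨ε, hε, h1⟩ := h1
  refine ⟨r / 4, by linarith, 2 * r, by linarith, ε, hε, fun s hs1 hs2 => ?_⟩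
  have h2 := h1 (y := s) (by rw [Real.dist_eq, abs_of_pos] <;> linarith) hs1
  set g : ℕ → ℝ := fun n => if n = 0 then 0 else
    (Nat.card {I : Ideal (𝓞 K) // Ideal.absNorm I = n} : ℝ) * (n : ℝ) ^ (-s) with hg
  have hg0 : ∀ n, 0 ≤ g n := by
    intro n; simp only [hg]; split_ifs <;> positivity
  have hz : dedekindZeta K s = ((∑' n, g n : ℝ) : ℂ) := by
    rw [dedekindZeta, LSeries, Complex.ofReal_tsum]
    congr 1
    ext n
    rw [LSeries.term_def]
    simp only [hg]
    split_ifs with h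
    · simp
    · push_cast
      rw [Complex.ofReal_cpow (by positivity), div_eq_mul_inv, ← Complex.cpow_neg]
      push_cast
      rfl
  have hs0 : 0 < s - 1 := by linarith
  have hnorm : ‖((s : ℂ) - 1) * dedekindZeta K s‖ = (s - 1) * ∑' n, g n := by
    rw [hz, norm_mul, Complex.norm_real, Real.norm_of_nonneg (tsum_nonneg hg0)]
    congr 1
    rw [← Complex.ofReal_one, ← Complex.ofReal_sub, Complex.norm_real, Real.norm_of_nonneg hs0.le]
  rw [hnorm] at h2
  have hsum : Summable g := by
    by_contra hns
    rw [tsum_eq_zero_of_not_summable hns] at h2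
    have := h2.1
    linarith
  have hfin : ∀ n : ℕ, {I : Ideal (𝓞 K) | Ideal.absNorm I = n}.Finite := fun n => by
    exact Ideal.finite_setOfPred_absNorm_eq n
  constructor
  · intro F hF
    rw [Finset.sum_comp (fun n : ℕ => (n : ℝ) ^ (-s)) (fun I : Ideal (𝓞 K) => Ideal.absNorm I)]
    calc _ ≤ ∑ n ∈ F.image (fun I => Ideal.absNorm I), g n := by
          refine Finset.sum_le_sum fun n hn => ?_
          obtain ⟨I, hI, rfl⟩ := Finset.mem_image.1 hn
          have hne : Ideal.absNorm I ≠ 0 := by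
            rw [Ne, Ideal.absNorm_eq_zero_iff]; exact hF I hI
          simp only [hg, if_neg hne, nsmul_eq_mul]
          refine mul_le_mul_of_nonneg_right ?_ (by positivity)
          have : Finite {J : Ideal (𝓞 K) // Ideal.absNorm J = Ideal.absNorm I} := hfin _
          rw [Nat.cast_le, ← Set.ncard_coe_finset]
          rw [show Nat.card {J : Ideal (𝓞 K) // Ideal.absNorm J = Ideal.absNorm I} =
            Set.ncard {J : Ideal (𝓞 K) | Ideal.absNorm J = Ideal.absNorm I} from rfl]
          refine Set.ncard_le_ncard ?_ (hfin _)
          intro J hJ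
          simpa using (by simpa using hJ : J ∈ F ∧ _).2
      _ ≤ ∑' n, g n := hsum.sum_le_tsum _ (fun n _ => hg0 n)
      _ ≤ _ := by
          rw [le_div_iff₀ hs0]; linarith [h2.2]
  · have h3 : r / 4 / (s - 1) < ∑' n, g n := by
      rw [div_lt_iff₀ hs0]; linarith [h2.1]
    obtain ⟨T, hT⟩ := ((hsum.hasSum).eventually (lt_mem_nhds h3)).exists
    have hfT : (⋃ n ∈ T.erase 0, {I : Ideal (𝓞 K) | Ideal.absNorm I = n}).Finite :=
      Set.Finite.biUnion (Finset.finite_toSet _) (fun n _ => hfin n)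
    refine ⟨(T.erase 0).biUnion (fun n => (hfin n).toFinset), ?_, ?_⟩
    · intro I hI hbot
      subst hbot
      simp at hI
    · refine hT.le.trans ?_
      rw [Finset.sum_biUnion]
      · rw [← Finset.sum_erase T (a := 0) (f := g) (by simp [hg])]
        refine Finset.sum_le_sum fun n hn => ?_
        have hn0 : n ≠ 0 := (Finset.mem_erase.1 hn).1
        simp only [hg, if_neg hn0]
        rw [Finset.sum_congr rfl (g := fun _ => (n : ℝ) ^ (-s)), Finset.sum_const, nsmul_eq_mul]
        · rw [show Nat.card {J : Ideal (𝓞 K) // Ideal.absNorm J = n} =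
            Set.ncard {J : Ideal (𝓞 K) | Ideal.absNorm J = n} from rfl,
            Set.ncard_eq_toFinset_card _ (hfin n)]
        · intro I hI
          have : Ideal.absNorm I = n := by simpa using hI
          rw [this]
      · intro a _ b _ hab
        refine Finset.disjoint_left.2 fun I h1 h2 => hab ?_
        have h1 : Ideal.absNorm I = a := by simpa using h1
        have h2 : Ideal.absNorm I = b := by simpa using h2
        exact h1.symm.trans h2

end Analytic

section Euler
open NumberField Filter Topology UniqueFactorizationMonoid

variable {K : Type*} [Field K] [NumberField K]

theorem aux_two_le_norm {I : Ideal (𝓞 K)} (hI : Prime I) : 2 ≤ Ideal.absNorm I := by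
  have h0 : Ideal.absNorm I ≠ 0 := by
    rw [Ne, Ideal.absNorm_eq_zero_iff]; exact hI.ne_zero
  have h1 : Ideal.absNorm I ≠ 1 := by
    rw [Ne, Ideal.absNorm_eq_one_iff]
    intro h
    exact hI.not_isUnit (by rw [h, ← Ideal.one_eq_top]; exact isUnit_one)
  omega

theorem aux_euler_upper (s : ℝ) (hs : 1 < s) (F : Finset (Ideal (𝓞 K))) (hF : ∀ I ∈ F, I ≠ ⊥) :
    ∃ P : Finset (Ideal (𝓞 K)), (∀ I ∈ P, Prime I) ∧
      ∑ I ∈ F, (Ideal.absNorm I : ℝ) ^ (-s) ≤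
        ∏ I ∈ P, (1 - (Ideal.absNorm I : ℝ) ^ (-s))⁻¹ := by
  classical
  set P : Finset (Ideal (𝓞 K)) := F.biUnion (fun I => (normalizedFactors I).toFinset) with hP
  have hPp : ∀ I ∈ P, Prime I := by
    intro I hI
    simp only [hP, Finset.mem_biUnion, Multiset.mem_toFinset] at hI
    obtain ⟨J, _, hJ⟩ := hI
    exact prime_of_normalized_factor I hJ
  refine ⟨P, hPp, ?_⟩
  set M := F.sup (fun I => Multiset.card (normalizedFactors I)) with hM
  set e : Ideal (𝓞 K) → (P → ℕ) := fun I i => (normalizedFactors I).count i.1 with he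
  have hprod : ∀ I ∈ F, I = ∏ i : P, i.1 ^ (e I i) := by
    intro I hI
    have h1 : (normalizedFactors I).prod = I := by
      rw [← associated_iff_eq]; exact prod_normalizedFactors (hF I hI)
    have h2 := Finset.prod_multiset_count_of_subset (normalizedFactors I) P
      (by intro J hJ; simp only [hP, Finset.mem_biUnion]; exact ⟨I, hI, hJ⟩)
    rw [h1] at h2
    rw [Finset.prod_coe_sort P (fun i => i ^ ((normalizedFactors I).count i))]
    exact h2
  have hw : ∀ I ∈ F, (Ideal.absNorm I : ℝ) ^ (-s) =
      ∏ i : P, ((Ideal.absNorm i.1 : ℝ) ^ (-s)) ^ (e I i) := by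
    intro I hI
    conv_lhs => rw [hprod I hI]
    rw [map_prod]
    push_cast
    rw [← Real.finsetProd_rpow _ _ (fun i _ => by positivity)]
    refine Finset.prod_congr rfl fun i _ => ?_
    rw [map_pow]
    push_cast
    rw [← Real.rpow_natCast, ← Real.rpow_natCast, ← Real.rpow_mul (by positivity),
      ← Real.rpow_mul (by positivity), mul_comm]
  rw [Finset.sum_congr rfl hw]
  have hinj : Set.InjOn e F := by
    intro I hI J hJ hIJ
    rw [hprod I hI, hprod J hJ, hIJ]
  rw [← Finset.sum_image (f := fun f : P → ℕ => ∏ i : P, ((Ideal.absNorm i.1 : ℝ) ^ (-s)) ^ (f i))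
    hinj]
  have hsub : F.image e ⊆ Fintype.piFinset (fun _ : P => Finset.range (M + 1)) := by
    intro f hf
    obtain ⟨I, hI, rfl⟩ := Finset.mem_image.1 hf
    rw [Fintype.mem_piFinset]
    intro i
    rw [Finset.mem_range, Nat.lt_succ_iff]
    exact (Multiset.count_le_card _ _).trans
      (Finset.le_sup (f := fun I => Multiset.card (normalizedFactors I)) hI)
  refine (Finset.sum_le_sum_of_subset_of_nonneg hsub (fun f _ _ => by positivity)).trans ?_
  rw [Finset.sum_prod_piFinset (Finset.range (M + 1))
    (fun (i : P) j => ((Ideal.absNorm i.1 : ℝ) ^ (-s)) ^ j)]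
  rw [← Finset.prod_coe_sort P]
  refine Finset.prod_le_prod (fun i _ => by positivity) fun i _ => ?_
  have h2 := aux_two_le_norm (hPp i.1 i.2)
  have hx0 : 0 ≤ (Ideal.absNorm i.1 : ℝ) ^ (-s) := by positivity
  have hx1 : (Ideal.absNorm i.1 : ℝ) ^ (-s) < 1 :=
    Real.rpow_lt_one_of_one_lt_of_neg (by exact_mod_cast (by omega : 1 < Ideal.absNorm i.1))
      (by linarith)
  rw [← tsum_geometric_of_lt_one hx0 hx1]
  exact (summable_geometric_of_lt_one hx0 hx1).sum_le_tsum _ (fun _ _ => by positivity)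

theorem aux_euler_lower (s : ℝ) (P : Finset (Ideal (𝓞 K))) (hP : ∀ I ∈ P, Prime I) :
    ∃ F : Finset (Ideal (𝓞 K)), (∀ I ∈ F, I ≠ ⊥) ∧
      ∏ I ∈ P, (1 + (Ideal.absNorm I : ℝ) ^ (-s)) ≤ ∑ I ∈ F, (Ideal.absNorm I : ℝ) ^ (-s) := by
  classical
  have key : ∀ T ∈ P.powerset, ∀ I, I ∈ T ↔ I ∈ P ∧ I ∣ ∏ J ∈ T, J := by
    intro T hT I
    rw [Finset.mem_powerset] at hT
    constructor
    · intro h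
      exact ⟨hT h, Finset.dvd_prod_of_mem _ h⟩
    · rintro ⟨h1, h2⟩
      rw [Prime.dvd_finsetProd_iff (hP I h1)] at h2
      obtain ⟨J, hJ, hIJ⟩ := h2
      rw [Prime.dvd_prime_iff_associated (hP I h1) (hP J (hT hJ)), associated_iff_eq] at hIJ
      rwa [hIJ]
  refine ⟨P.powerset.image (fun T => ∏ J ∈ T, J), ?_, ?_⟩
  · intro I hI
    obtain ⟨T, hT, rfl⟩ := Finset.mem_image.1 hI
    rw [Finset.mem_powerset] at hT
    rw [← Ideal.zero_eq_bot, Finset.prod_ne_zero_iff]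
    exact fun J hJ => (hP J (hT hJ)).ne_zero
  · rw [Finset.prod_one_add, Finset.sum_image]
    · refine Finset.sum_le_sum fun T _ => ?_
      rw [map_prod]
      push_cast
      rw [Real.finsetProd_rpow _ _ (fun i _ => by positivity)]
    · intro T hT T' hT' h
      ext I
      rw [key T hT I, key T' hT' I]
      simp only at h
      rw [h]

theorem aux_E (hzb : ∃ c : ℝ, 0 < c ∧ ∃ C : ℝ, 0 < C ∧ ∃ ε : ℝ, 0 < ε ∧ ∀ s : ℝ, 1 < s → s < 1 + ε →
      (∀ F : Finset (Ideal (𝓞 K)), (∀ I ∈ F, I ≠ ⊥) →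
        ∑ I ∈ F, (Ideal.absNorm I : ℝ) ^ (-s) ≤ C / (s - 1)) ∧
      ∃ F : Finset (Ideal (𝓞 K)), (∀ I ∈ F, I ≠ ⊥) ∧
        c / (s - 1) ≤ ∑ I ∈ F, (Ideal.absNorm I : ℝ) ^ (-s)) :
    ∃ C : ℝ, ∃ ε : ℝ, 0 < ε ∧ ∀ s : ℝ, 1 < s → s < 1 + ε →
      (∀ P : Finset (Ideal (𝓞 K)), (∀ I ∈ P, Prime I) →
        ∑ I ∈ P, ((Ideal.absNorm I : ℝ) ^ (-s) - ((Ideal.absNorm I : ℝ) ^ (-s)) ^ 2) ≤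
          -Real.log (s - 1) + C) ∧
      ∃ P : Finset (Ideal (𝓞 K)), (∀ I ∈ P, Prime I) ∧
        -Real.log (s - 1) - C ≤
          ∑ I ∈ P, ((Ideal.absNorm I : ℝ) ^ (-s) + 2 * ((Ideal.absNorm I : ℝ) ^ (-s)) ^ 2) := by
  obtain ⟨c, hc, C, hC, ε, hε, h⟩ := hzb
  have hx : ∀ s : ℝ, 1 < s → ∀ I : Ideal (𝓞 K), Prime I → 0 < (Ideal.absNorm I : ℝ) ^ (-s) ∧
      (Ideal.absNorm I : ℝ) ^ (-s) ≤ 1 / 2 := by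
    intro s hs I hI
    have h2 := aux_two_le_norm hI
    have h2' : (2 : ℝ) ≤ Ideal.absNorm I := by exact_mod_cast h2
    refine ⟨by positivity, ?_⟩
    calc (Ideal.absNorm I : ℝ) ^ (-s) ≤ (Ideal.absNorm I : ℝ) ^ (-1 : ℝ) :=
          Real.rpow_le_rpow_of_exponent_le (by linarith) (by linarith)
      _ = 1 / (Ideal.absNorm I : ℝ) := by rw [Real.rpow_neg_one, one_div]
      _ ≤ 1 / 2 := by gcongr
  refine ⟨max (Real.log C) (-Real.log c), ε, hε, fun s hs1 hs2 => ?_⟩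
  obtain ⟨hu, F, hF, hl⟩ := h s hs1 hs2
  have hs0 : 0 < s - 1 := by linarith
  constructor
  · intro P hP
    obtain ⟨F, hF, hle⟩ := aux_euler_lower s P hP
    have h1 := hle.trans (hu F hF)
    have h2 : Real.exp (∑ I ∈ P, ((Ideal.absNorm I : ℝ) ^ (-s) -
        ((Ideal.absNorm I : ℝ) ^ (-s)) ^ 2)) ≤ ∏ I ∈ P, (1 + (Ideal.absNorm I : ℝ) ^ (-s)) := by
      rw [Real.exp_sum]
      refine Finset.prod_le_prod (fun _ _ => by positivity) fun I hI => ?_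
      obtain ⟨hx0, hx1⟩ := hx s hs1 I (hP I hI)
      set x := (Ideal.absNorm I : ℝ) ^ (-s)
      have h3 := Real.add_one_le_exp (-(x - x ^ 2))
      rw [Real.exp_neg] at h3
      have h4 := Real.exp_pos (x - x ^ 2)
      set y := Real.exp (x - x ^ 2)
      have h5 : (-(x - x ^ 2) + 1) * y ≤ 1 := by
        calc _ ≤ y⁻¹ * y := by gcongr
          _ = 1 := inv_mul_cancel₀ h4.ne'
      have h6 : 0 < 1 - x + x ^ 2 := by nlinarith
      have h7 : (1 - x + x ^ 2) * y ≤ (1 - x + x ^ 2) * (1 + x) := by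
        have : (1 - x + x ^ 2) * (1 + x) = 1 + x ^ 3 := by ring
        have : 0 < x ^ 3 := by positivity
        nlinarith
      exact le_of_mul_le_mul_left h7 h6
    have h3 := (Real.le_log_iff_exp_le (by positivity)).2 (h2.trans h1)
    rw [Real.log_div hC.ne' hs0.ne'] at h3
    linarith [le_max_left (Real.log C) (-Real.log c)]
  · obtain ⟨P, hP, hle⟩ := aux_euler_upper s hs1 F hF
    refine ⟨P, hP, ?_⟩
    have h1 := hl.trans hle
    have h2 : ∏ I ∈ P, (1 - (Ideal.absNorm I : ℝ) ^ (-s))⁻¹ ≤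
        Real.exp (∑ I ∈ P, ((Ideal.absNorm I : ℝ) ^ (-s) +
          2 * ((Ideal.absNorm I : ℝ) ^ (-s)) ^ 2)) := by
      rw [Real.exp_sum]
      refine Finset.prod_le_prod (fun I hI => ?_) fun I hI => ?_
      · obtain ⟨hx0, hx1⟩ := hx s hs1 I (hP I hI)
        rw [inv_nonneg]; linarith
      · obtain ⟨hx0, hx1⟩ := hx s hs1 I (hP I hI)
        set x := (Ideal.absNorm I : ℝ) ^ (-s)
        have h3 := Real.add_one_le_exp (x + 2 * x ^ 2)
        refine le_trans ?_ h3
        rw [inv_le_iff_one_le_mul₀ (by linarith)]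
        nlinarith [sq_nonneg x, mul_nonneg (sq_nonneg x) (by linarith : 0 ≤ 1 - 2 * x)]
    have h3 := (Real.log_le_iff_le_exp (by positivity)).2 (h1.trans h2)
    rw [Real.log_div hc.ne' hs0.ne'] at h3
    linarith [le_max_right (Real.log C) (-Real.log c)]

theorem aux_card_le (p : ℕ) (hp : p.Prime) (P : Finset (Ideal (𝓞 K))) (hP : ∀ I ∈ P, Prime I)
    (hpP : ∀ I ∈ P, (p : 𝓞 K) ∈ I) : P.card ≤ Module.finrank ℚ K := by
  classical
  have h1 : ∏ I ∈ P, I ∣ Ideal.span {(p : 𝓞 K)} := by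
    refine Finset.prod_primes_dvd _ hP fun I hI => ?_
    rw [Ideal.dvd_span_singleton]; exact hpP I hI
  have h2 : Ideal.absNorm (∏ I ∈ P, I) ∣ p ^ Module.finrank ℚ K := by
    have h := map_dvd Ideal.absNorm h1
    rw [Ideal.absNorm_span_singleton] at h
    have h3 : Algebra.norm ℤ ((p : ℕ) : 𝓞 K) = (p : ℤ) ^ Module.finrank ℚ K := by
      rw [← NumberField.RingOfIntegers.rank K, ← Algebra.norm_algebraMap (S := 𝓞 K) (p : ℤ)]
      simp
    rw [h3] at h
    simpa using h
  rw [map_prod] at h2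
  have h3 : ∀ I ∈ P, p ∣ Ideal.absNorm I := by
    intro I hI
    have : Ideal.absNorm I ∣ p ^ Module.finrank ℚ K := (Finset.dvd_prod_of_mem _ hI).trans h2
    obtain ⟨f, _, hf⟩ := (Nat.dvd_prime_pow hp).1 this
    have := aux_two_le_norm (hP I hI)
    rw [hf] at this ⊢
    refine dvd_pow_self _ ?_
    rintro rfl
    simp at this
  have h4 : p ^ P.card ∣ p ^ Module.finrank ℚ K := by
    refine dvd_trans ?_ h2
    rw [← Finset.prod_const]
    exact Finset.prod_dvd_prod_of_dvd _ _ h3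
  exact (Nat.pow_dvd_pow_iff_le_right hp.one_lt).1 h4

theorem aux_exists_under (I : Ideal (𝓞 K)) : ∃ p f : ℕ, Prime I →
    p.Prime ∧ 1 ≤ f ∧ (p : 𝓞 K) ∈ I ∧ Ideal.absNorm I = p ^ f := by
  by_cases hI : Prime I
  swap
  · exact ⟨0, 0, fun h => (hI h).elim⟩
  have hIp : I.IsPrime := Ideal.isPrime_of_prime hI
  have h1 := Ideal.absNorm_mem I
  have h2 := aux_two_le_norm hI
  have h3 : ∃ p ∈ (Ideal.absNorm I).primeFactorsList, (p : 𝓞 K) ∈ I := by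
    rw [← Nat.prod_primeFactorsList (by omega : Ideal.absNorm I ≠ 0)] at h1
    rw [Nat.cast_list_prod] at h1
    rw [← Multiset.prod_coe, hIp.multiset_prod_mem_iff_exists_mem] at h1
    obtain ⟨x, hx, hxI⟩ := h1
    obtain ⟨p, hp, rfl⟩ := List.mem_map.1 (Multiset.mem_coe.1 hx)
    exact ⟨p, hp, hxI⟩
  obtain ⟨p, hp, hpI⟩ := h3
  have hpp := Nat.prime_of_mem_primeFactorsList hp
  have h4 : Ideal.absNorm I ∣ p ^ Module.finrank ℚ K := by
    have h := map_dvd Ideal.absNorm ((Ideal.dvd_span_singleton).2 hpI)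
    rw [Ideal.absNorm_span_singleton] at h
    have h3 : Algebra.norm ℤ ((p : ℕ) : 𝓞 K) = (p : ℤ) ^ Module.finrank ℚ K := by
      rw [← NumberField.RingOfIntegers.rank K, ← Algebra.norm_algebraMap (S := 𝓞 K) (p : ℤ)]
      simp
    rw [h3] at h
    simpa using h
  obtain ⟨f, _, hf⟩ := (Nat.dvd_prime_pow hpp).1 h4
  refine ⟨p, f, fun _ => ⟨hpp, ?_, hpI, hf⟩⟩
  by_contra h
  have : f = 0 := by omega
  rw [hf, this] at h2
  simp at h2

end Euler

section Density
open NumberField Filter Topology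

theorem aux_sum_fiber {K : Type*} [Field K] [NumberField K] (pp : Ideal (𝓞 K) → ℕ)
    (P : Finset (Ideal (𝓞 K))) (hP : ∀ I ∈ P, Prime I)
    (hpp : ∀ I ∈ P, (pp I).Prime ∧ ((pp I : ℕ) : 𝓞 K) ∈ I) (h : ℕ → ℝ) (h0 : ∀ n, 0 ≤ h n) :
    ∑ I ∈ P, h (pp I) ≤ (Module.finrank ℚ K : ℝ) * ∑ n ∈ P.image pp, h n := by
  classical
  rw [Finset.sum_comp h pp, Finset.mul_sum]
  refine Finset.sum_le_sum fun n hn => ?_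
  rw [nsmul_eq_mul]
  refine mul_le_mul_of_nonneg_right ?_ (h0 n)
  obtain ⟨J, hJ, rfl⟩ := Finset.mem_image.1 hn
  rw [Nat.cast_le]
  refine aux_card_le (pp J) (hpp J hJ).1 _ (fun I hI => hP I (Finset.mem_filter.1 hI).1) ?_
  intro I hI
  rw [Finset.mem_filter] at hI
  rw [← hI.2]
  exact (hpp I hI.1).2

theorem aux_sum_inv_sq (T : Finset ℕ) : ∑ n ∈ T, ((n : ℝ) ^ 2)⁻¹ ≤ ∑' n : ℕ, ((n : ℝ) ^ 2)⁻¹ :=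
  (Real.summable_nat_pow_inv.2 (by norm_num)).sum_le_tsum _ (fun _ _ => by positivity)

/-- prime ideals whose squares-norm sums are bounded -/
theorem aux_sum_le_of_sq {K : Type*} [Field K] [NumberField K] (pp : Ideal (𝓞 K) → ℕ)
    (P : Finset (Ideal (𝓞 K))) (hP : ∀ I ∈ P, Prime I)
    (hpp : ∀ I ∈ P, (pp I).Prime ∧ ((pp I : ℕ) : 𝓞 K) ∈ I) (g : Ideal (𝓞 K) → ℝ)
    (hg : ∀ I ∈ P, g I ≤ ((pp I : ℝ) ^ 2)⁻¹) :
    ∑ I ∈ P, g I ≤ (Module.finrank ℚ K : ℝ) * ∑' n : ℕ, ((n : ℝ) ^ 2)⁻¹ := by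
  refine (Finset.sum_le_sum hg).trans ?_
  refine (aux_sum_fiber pp P hP hpp (fun n => ((n : ℝ) ^ 2)⁻¹) (fun n => by positivity)).trans ?_
  exact mul_le_mul_of_nonneg_left (aux_sum_inv_sq _) (by positivity)

theorem aux_rpow_sq (p f : ℕ) (hp : p.Prime) (s : ℝ) (hs : 1 < s) (hf : 2 ≤ f) :
    ((p ^ f : ℕ) : ℝ) ^ (-s) ≤ ((p : ℝ) ^ 2)⁻¹ := by
  have hp1 : (1 : ℝ) < p := by exact_mod_cast hp.one_lt
  have h1 : (1 : ℝ) ≤ ((p ^ f : ℕ) : ℝ) := by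
    exact_mod_cast Nat.one_le_pow _ _ hp.pos
  calc ((p ^ f : ℕ) : ℝ) ^ (-s) ≤ ((p ^ f : ℕ) : ℝ) ^ (-1 : ℝ) :=
        Real.rpow_le_rpow_of_exponent_le h1 (by linarith)
    _ = ((p : ℝ) ^ f)⁻¹ := by rw [Real.rpow_neg_one]; push_cast; rfl
    _ ≤ ((p : ℝ) ^ 2)⁻¹ := by gcongr; exact hp1.le

theorem aux_rpow_sq' (p f : ℕ) (hp : p.Prime) (s : ℝ) (hs : 1 < s) (hf : 1 ≤ f) :
    (((p ^ f : ℕ) : ℝ) ^ (-s)) ^ 2 ≤ ((p : ℝ) ^ 2)⁻¹ := by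
  refine le_trans (le_of_eq ?_) (aux_rpow_sq p (f * 2) hp s hs (by omega))
  rw [pow_mul, ← Real.rpow_natCast, ← Real.rpow_mul (by positivity), mul_comm,
    Real.rpow_mul (by positivity)]
  push_cast
  norm_num

theorem aux_E' (K : Type*) [Field K] [NumberField K] :
    ∃ C : ℝ, ∃ ε : ℝ, 0 < ε ∧ ∀ s : ℝ, 1 < s → s < 1 + ε →
      (∀ P : Finset (Ideal (𝓞 K)), (∀ I ∈ P, Prime I) →
        ∑ I ∈ P, (Ideal.absNorm I : ℝ) ^ (-s) ≤ -Real.log (s - 1) + C) ∧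
      ∃ P : Finset (Ideal (𝓞 K)), (∀ I ∈ P, Prime I) ∧
        -Real.log (s - 1) - C ≤ ∑ I ∈ P, (Ideal.absNorm I : ℝ) ^ (-s) := by
  obtain ⟨C, ε, hε, h⟩ := aux_E (aux_zb K)
  choose pp ff hpf using aux_exists_under (K := K)
  set Z := (Module.finrank ℚ K : ℝ) * ∑' n : ℕ, ((n : ℝ) ^ 2)⁻¹ with hZ
  have hZ0 : 0 ≤ Z := by
    refine mul_nonneg (by positivity) (tsum_nonneg fun _ => by positivity)
  have hb : ∀ s : ℝ, 1 < s → ∀ P : Finset (Ideal (𝓞 K)), (∀ I ∈ P, Prime I) →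
      ∑ I ∈ P, ((Ideal.absNorm I : ℝ) ^ (-s)) ^ 2 ≤ Z := by
    intro s hs P hP
    refine aux_sum_le_of_sq pp P hP (fun I hI => ?_) _ fun I hI => ?_
    · have := hpf I (hP I hI)
      exact ⟨this.1, this.2.2.1⟩
    · have := hpf I (hP I hI)
      rw [this.2.2.2]
      exact aux_rpow_sq' _ _ this.1 s hs this.2.1
  refine ⟨C + 2 * Z, ε, hε, fun s hs1 hs2 => ?_⟩
  obtain ⟨h1, P, hP, h2⟩ := h s hs1 hs2
  constructor
  · intro P hP
    have h3 := h1 P hP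
    have h4 := hb s hs1 P hP
    rw [Finset.sum_sub_distrib] at h3
    linarith
  · refine ⟨P, hP, ?_⟩
    have h4 := hb s hs1 P hP
    rw [Finset.sum_add_distrib, ← Finset.mul_sum] at h2
    linarith

theorem aux_hom_of_norm {K : Type*} [Field K] [NumberField K] (I : Ideal (𝓞 K)) (p : ℕ)
    (hp : p.Prime) (hI : Ideal.absNorm I = p) : Nonempty (𝓞 K →+* ZMod p) := by
  have hcard : Nat.card (𝓞 K ⧸ I) = p := by
    rw [← hI, Ideal.absNorm_apply, Submodule.cardQuot_apply]
  have : Finite (𝓞 K ⧸ I) := Nat.finite_of_card_ne_zero (by rw [hcard]; exact hp.ne_zero)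
  have := Fintype.ofFinite (𝓞 K ⧸ I)
  rw [Nat.card_eq_fintype_card] at hcard
  exact ⟨(ZMod.ringEquivOfPrime _ hp hcard).symm.toRingHom.comp (Ideal.Quotient.mk I)⟩

theorem aux_ker_hom {K : Type*} [Field K] [NumberField K] (p : ℕ) (hp : p.Prime) :
    Function.Injective (fun φ : 𝓞 K →+* ZMod p => RingHom.ker φ) ∧
    ∀ φ : 𝓞 K →+* ZMod p, Prime (RingHom.ker φ) ∧ Ideal.absNorm (RingHom.ker φ) = p ∧
      (p : 𝓞 K) ∈ RingHom.ker φ := by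
  have : Fact p.Prime := ⟨hp⟩
  refine ⟨fun φ ψ h => ?_, fun φ => ?_⟩
  · ext x
    have h1 : x - ((φ x).val : 𝓞 K) ∈ RingHom.ker φ := by
      rw [RingHom.mem_ker, map_sub, map_natCast, ZMod.natCast_zmod_val, sub_self]
    simp only at h
    rw [h, RingHom.mem_ker, map_sub, map_natCast, ZMod.natCast_zmod_val, sub_eq_zero] at h1
    exact h1.symm
  · have hmem : (p : 𝓞 K) ∈ RingHom.ker φ := by
      rw [RingHom.mem_ker, map_natCast, ZMod.natCast_self]
    have hpr : (RingHom.ker φ).IsPrime := RingHom.ker_isPrime φ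
    have hne : RingHom.ker φ ≠ ⊥ := by
      intro h
      rw [h, Ideal.mem_bot] at hmem
      exact hp.ne_zero (by exact_mod_cast hmem)
    refine ⟨Ideal.prime_of_isPrime hne hpr, ?_, hmem⟩
    have hsurj : Function.Surjective φ := ZMod.ringHom_surjective φ
    rw [Ideal.absNorm_apply, Submodule.cardQuot_apply,
      Nat.card_congr (RingHom.quotientKerEquivOfSurjective hsurj).toEquiv, Nat.card_zmod]

theorem aux_density (K L : Type*) [Field K] [NumberField K] [Field L] [NumberField L]
    (hKL : Module.finrank ℚ K < Module.finrank ℚ L) (A : Set ℕ) (X : Finset ℕ)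
    (hA : ∀ p : ℕ, p.Prime → p ∉ X → Nonempty (𝓞 K →+* ZMod p) → p ∈ A)
    (hB : ∀ p : ℕ, p.Prime → p ∉ X → p ∈ A → ∃ T : Finset (𝓞 L →+* ZMod p),
      Module.finrank ℚ L ≤ T.card) : False := by
  classical
  obtain ⟨C, ε, hε, h⟩ := aux_E' K
  obtain ⟨C', ε', hε', h'⟩ := aux_E' L
  choose pp ff hpf using aux_exists_under (K := K)
  set d : ℝ := ((Module.finrank ℚ K : ℕ) : ℝ) with hd
  set D : ℝ := ((Module.finrank ℚ L : ℕ) : ℝ) with hD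
  have hd1 : 1 ≤ d := by
    rw [hd]; exact_mod_cast (Module.finrank_pos (R := ℚ) (M := K))
  have hdD : d + 1 ≤ D := by
    rw [hd, hD]; exact_mod_cast hKL
  set Z := d * ∑' n : ℕ, ((n : ℝ) ^ 2)⁻¹ with hZ
  -- main inequality
  have main : ∀ s : ℝ, 1 < s → s < 1 + min ε ε' →
      (-Real.log (s - 1) - C - Z - d * X.card) * D ≤ (-Real.log (s - 1) + C') * d := by
    intro s hs1 hs2
    have hs3 : s < 1 + ε := hs2.trans_le (by gcongr; exact min_le_left _ _)
    have hs4 : s < 1 + ε' := hs2.trans_le (by gcongr; exact min_le_right _ _)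
    obtain ⟨-, P, hP, hlow⟩ := h s hs1 hs3
    obtain ⟨hup, -⟩ := h' s hs1 hs4
    set P1 := P.filter (fun I => ff I = 1) with hP1
    set P2 := P.filter (fun I => ¬ ff I = 1) with hP2
    have hP1p : ∀ I ∈ P1, Prime I := fun I hI => hP I (Finset.mem_filter.1 hI).1
    have hP2p : ∀ I ∈ P2, Prime I := fun I hI => hP I (Finset.mem_filter.1 hI).1
    have hsplit : ∑ I ∈ P, (Ideal.absNorm I : ℝ) ^ (-s) =
        ∑ I ∈ P1, (Ideal.absNorm I : ℝ) ^ (-s) + ∑ I ∈ P2, (Ideal.absNorm I : ℝ) ^ (-s) :=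
      (Finset.sum_filter_add_sum_filter_not _ _ _).symm
    have h2 : ∑ I ∈ P2, (Ideal.absNorm I : ℝ) ^ (-s) ≤ Z := by
      refine aux_sum_le_of_sq pp P2 hP2p (fun I hI => ?_) _ fun I hI => ?_
      · have := hpf I (hP2p I hI)
        exact ⟨this.1, this.2.2.1⟩
      · have := hpf I (hP2p I hI)
        have hf := (Finset.mem_filter.1 hI).2
        rw [this.2.2.2]
        exact aux_rpow_sq _ _ this.1 s hs1 (by omega)
    have h1 : ∑ I ∈ P1, (Ideal.absNorm I : ℝ) ^ (-s) ≤
        d * ∑ n ∈ P1.image pp, (n : ℝ) ^ (-s) := by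
      have heq : ∑ I ∈ P1, (Ideal.absNorm I : ℝ) ^ (-s) = ∑ I ∈ P1, ((pp I : ℕ) : ℝ) ^ (-s) := by
        refine Finset.sum_congr rfl fun I hI => ?_
        have := hpf I (hP1p I hI)
        have hf := (Finset.mem_filter.1 hI).2
        rw [this.2.2.2, hf, pow_one]
      rw [heq]
      refine aux_sum_fiber pp P1 hP1p (fun I hI => ?_) (fun n => (n : ℝ) ^ (-s))
        (fun n => by positivity)
      have := hpf I (hP1p I hI)
      exact ⟨this.1, this.2.2.1⟩
    set Q := (P1.image pp).filter (fun n => n ∉ X) with hQ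
    have hQmem : ∀ n ∈ Q, n.Prime ∧ n ∉ X ∧ n ∈ A := by
      intro n hn
      obtain ⟨hn1, hn2⟩ := Finset.mem_filter.1 hn
      obtain ⟨I, hI, rfl⟩ := Finset.mem_image.1 hn1
      have := hpf I (hP1p I hI)
      have hf := (Finset.mem_filter.1 hI).2
      refine ⟨this.1, hn2, hA _ this.1 hn2 (aux_hom_of_norm I _ this.1 ?_)⟩
      rw [this.2.2.2, hf, pow_one]
    have h3 : ∑ n ∈ P1.image pp, (n : ℝ) ^ (-s) ≤ X.card + ∑ n ∈ Q, (n : ℝ) ^ (-s) := by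
      rw [← Finset.sum_filter_add_sum_filter_not (P1.image pp) (fun n => n ∈ X)]
      refine add_le_add ?_ le_rfl
      calc _ ≤ ∑ n ∈ (P1.image pp).filter (fun n => n ∈ X), (1 : ℝ) := by
            refine Finset.sum_le_sum fun n hn => ?_
            obtain ⟨I, hI, rfl⟩ := Finset.mem_image.1 (Finset.mem_filter.1 hn).1
            have := (hpf I (hP1p I hI)).1.one_lt
            exact Real.rpow_le_one_of_one_le_of_nonpos (by exact_mod_cast this.le) (by linarith)
        _ = (((P1.image pp).filter (fun n => n ∈ X)).card : ℝ) := by simp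
        _ ≤ X.card := by
            rw [Nat.cast_le]
            exact Finset.card_le_card (fun n hn => (Finset.mem_filter.1 hn).2)
    -- primes of L
    have h4 : D * ∑ n ∈ Q, (n : ℝ) ^ (-s) ≤ -Real.log (s - 1) + C' := by
      have hT : ∀ n : ℕ, ∃ T : Finset (Ideal (𝓞 L)), n ∈ Q →
          Module.finrank ℚ L ≤ T.card ∧ ∀ I ∈ T, Prime I ∧ Ideal.absNorm I = n := by
        intro n
        by_cases hn : n ∈ Q
        · obtain ⟨h1, h2, h3⟩ := hQmem n hn
          obtain ⟨T, hT⟩ := hB n h1 h2 h3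
          obtain ⟨k1, k2⟩ := aux_ker_hom (K := L) n h1
          refine ⟨T.image (fun φ => RingHom.ker φ), fun _ => ⟨?_, ?_⟩⟩
          · rwa [Finset.card_image_of_injective _ k1]
          · intro I hI
            obtain ⟨φ, _, rfl⟩ := Finset.mem_image.1 hI
            exact ⟨(k2 φ).1, (k2 φ).2.1⟩
        · exact ⟨∅, fun h => (hn h).elim⟩
      choose T hT using hT
      have := hup (Q.biUnion T) (by
        intro I hI
        obtain ⟨n, hn, hI⟩ := Finset.mem_biUnion.1 hI
        exact ((hT n hn).2 I hI).1)
      refine le_trans ?_ this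
      rw [Finset.sum_biUnion, Finset.mul_sum]
      · refine Finset.sum_le_sum fun n hn => ?_
        rw [Finset.sum_congr rfl (g := fun _ => (n : ℝ) ^ (-s))
          (fun I hI => by rw [((hT n hn).2 I hI).2]), Finset.sum_const, nsmul_eq_mul]
        refine mul_le_mul_of_nonneg_right ?_ (by positivity)
        rw [hD, Nat.cast_le]
        exact (hT n hn).1
      · intro a ha b hb hab
        refine Finset.disjoint_left.2 fun I h1 h2 => hab ?_
        rw [← ((hT a ha).2 I h1).2, ← ((hT b hb).2 I h2).2]
    set U := ∑ n ∈ Q, (n : ℝ) ^ (-s)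
    have h5 : -Real.log (s - 1) - C - Z - d * X.card ≤ d * U := by nlinarith
    calc (-Real.log (s - 1) - C - Z - d * X.card) * D ≤ d * U * D :=
          mul_le_mul_of_nonneg_right h5 (by linarith)
      _ = (D * U) * d := by ring
      _ ≤ _ := mul_le_mul_of_nonneg_right h4 (by linarith)
  -- contradiction
  set M := C' * d + (C + Z + d * X.card) * D with hM
  have main2 : ∀ s : ℝ, 1 < s → s < 1 + min ε ε' → -Real.log (s - 1) < 1 ∨
      -Real.log (s - 1) ≤ M := by
    intro s h1 h2
    have := main s h1 h2
    by_cases hl : -Real.log (s - 1) < 1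
    · exact Or.inl hl
    · right
      push Not at hl
      nlinarith
  have hmin : 0 < min ε ε' := lt_min hε hε'
  set t := min (min ε ε' / 2) (Real.exp (-(|M| + 2))) with ht
  have ht0 : 0 < t := lt_min (by linarith) (Real.exp_pos _)
  have hlog : Real.log t ≤ -(|M| + 2) := by
    rw [Real.log_le_iff_le_exp ht0]; exact min_le_right _ _
  have hM' := le_abs_self M
  have hM0 := abs_nonneg M
  have ht1 : t ≤ min ε ε' / 2 := min_le_left _ _
  rcases main2 (1 + t) (by linarith) (by linarith) with h | h
  · rw [add_sub_cancel_left] at h; linarith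
  · rw [add_sub_cancel_left] at h; linarith

end Density


section Frobenius
open NumberField

theorem aux_nat_mem {S : Type*} [CommRing S] (P : Ideal S) [hP : P.IsPrime] (p : ℕ)
    (hp : p.Prime) (hpP : (p : S) ∈ P) (k : ℕ) (hk : (k : S) ∈ P) : p ∣ k := by
  by_contra h
  have hc : IsCoprime (p : ℤ) (k : ℤ) := by
    rw [Nat.isCoprime_iff_coprime]
    exact (Nat.Prime.coprime_iff_not_dvd hp).2 h
  obtain ⟨a, b, hab⟩ := hc
  apply hP.ne_top
  rw [Ideal.eq_top_iff_one]
  have : (1 : S) = (a : S) * (p : S) + (b : S) * (k : S) := by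
    have := congrArg (Int.cast : ℤ → S) hab
    push_cast at this
    exact this.symm
  rw [this]
  exact P.add_mem (P.mul_mem_left _ hpP) (P.mul_mem_left _ hk)

theorem aux_sep {S : Type*} [CommRing S] [IsDomain S] (P : Ideal S) [hP : P.IsPrime] (p q m : ℕ)
    (hp : p.Prime) (hpP : (p : S) ∈ P) (hq : q.Prime) (hpq : p ≠ q) (hpm : ¬ p ∣ m) (x y : S)
    (hx : x ^ q = m) (hy : y ^ q = m) (hxy : x - y ∈ P) : x = y := by
  by_contra hne
  have h1 : (∑ i ∈ range q, x ^ i * y ^ (q - 1 - i)) * (x - y) = 0 := by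
    rw [(Commute.all x y).geom_sum₂_mul, hx, hy, sub_self]
  have h2 : ∑ i ∈ range q, x ^ i * y ^ (q - 1 - i) = 0 := by
    rcases mul_eq_zero.1 h1 with h | h
    · exact h
    · exact (hne (sub_eq_zero.1 h)).elim
  have h3 : Ideal.Quotient.mk P x = Ideal.Quotient.mk P y := Ideal.Quotient.eq.2 hxy
  have h4 := congrArg (Ideal.Quotient.mk P) h2
  rw [map_sum, map_zero] at h4
  have h5 : ∀ i ∈ range q, Ideal.Quotient.mk P (x ^ i * y ^ (q - 1 - i)) =
      Ideal.Quotient.mk P x ^ (q - 1) := by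
    intro i hi
    rw [Finset.mem_range] at hi
    rw [map_mul, map_pow, map_pow, ← h3, ← pow_add]
    congr 1
    omega
  rw [Finset.sum_congr rfl h5, Finset.sum_const, card_range, nsmul_eq_mul] at h4
  rcases mul_eq_zero.1 h4 with h | h
  · have : (q : S) ∈ P := by
      rw [← Ideal.Quotient.eq_zero_iff_mem, map_natCast]; exact h
    have := aux_nat_mem P p hp hpP q this
    exact hpq ((Nat.prime_dvd_prime_iff_eq hp hq).1 this)
  · have h6 : Ideal.Quotient.mk P x = 0 := eq_zero_of_pow_eq_zero h
    rw [Ideal.Quotient.eq_zero_iff_mem] at h6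
    have : (m : S) ∈ P := by
      rw [← hx]; exact Ideal.pow_mem_of_mem P h6 q hq.pos
    exact hpm (aux_nat_mem P p hp hpP m this)

theorem aux_homs (L : Type*) [Field L] [NumberField L] [IsGalois ℚ L] (q : ℕ) (hq : q.Prime)
    (R : Set (𝓞 L)) (hR : ∀ σ τ : L ≃ₐ[ℚ] L, (∀ x ∈ R, σ • x = τ • x) → σ = τ)
    (m : 𝓞 L → ℕ) (hm : ∀ x ∈ R, x ^ q = (m x : 𝓞 L)) (p : ℕ) (hp : p.Prime) (hpq : p ≠ q)
    (hpm : ∀ x ∈ R, ¬ p ∣ m x) (h1 : q ∣ p - 1) (hpow : ∀ x ∈ R, ∃ y : ZMod p, y ^ q = m x) :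
    ∃ T : Finset (𝓞 L →+* ZMod p), Module.finrank ℚ L ≤ T.card := by
  classical
  have : Fact p.Prime := ⟨hp⟩
  have hspan : Ideal.span {(p : 𝓞 L)} ≠ ⊤ := by
    rw [Ne, ← Ideal.absNorm_eq_one_iff, Ideal.absNorm_span_singleton]
    have h3 : Algebra.norm ℤ ((p : ℕ) : 𝓞 L) = (p : ℤ) ^ Module.finrank ℚ L := by
      rw [← NumberField.RingOfIntegers.rank L, ← Algebra.norm_algebraMap (S := 𝓞 L) (p : ℤ)]
      simp
    rw [h3, Int.natAbs_pow, Int.natAbs_natCast, Nat.pow_eq_one]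
    have := Module.finrank_pos (R := ℚ) (M := L)
    have := hp.one_lt
    omega
  obtain ⟨P, hPmax, hP⟩ := Ideal.exists_le_maximal _ hspan
  have hpP : (p : 𝓞 L) ∈ P := hP (Ideal.mem_span_singleton_self _)
  have hPp : P.IsPrime := hPmax.isPrime
  have hPbot : P ≠ ⊥ := by
    rintro rfl
    rw [Ideal.mem_bot] at hpP
    exact hp.ne_zero (by exact_mod_cast hpP)
  have hfin : Finite (𝓞 L ⧸ P) := Ideal.finiteQuotientOfFreeOfNeBot P hPbot
  obtain ⟨σ, hσ⟩ := IsArithFrobAt.exists_of_isInvariant ℤ (L ≃ₐ[ℚ] L) P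
  have hunder : P.under ℤ = Ideal.span {(p : ℤ)} := by
    have hmax : (Ideal.span {(p : ℤ)}).IsMaximal := Int.ideal_span_isMaximal_of_prime p
    refine (hmax.eq_of_le (Ideal.IsPrime.ne_top inferInstance) ?_).symm
    rw [Ideal.span_singleton_le_iff_mem, Ideal.mem_comap]
    simpa using hpP
  have hcardZ : Nat.card (ℤ ⧸ P.under ℤ) = p := by
    rw [hunder, Nat.card_congr (Int.quotientSpanEquivZMod (p : ℤ)).toEquiv]
    simp
  have hσ' : ∀ x : 𝓞 L, σ • x - x ^ p ∈ P := by
    intro x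
    have := hσ x
    rw [hcardZ] at this
    exact this
  have hRx : ∀ x ∈ R, ∀ τ : L ≃ₐ[ℚ] L, (τ • x) ^ q = (m x : 𝓞 L) := by
    intro x hx τ
    rw [← smul_pow', hm x hx]
    exact map_natCast (MulSemiringAction.toRingHom (L ≃ₐ[ℚ] L) (𝓞 L) τ) _
  have hsig : σ = 1 := by
    refine hR σ 1 fun x hx => ?_
    rw [one_smul]
    refine aux_sep P p q (m x) hp hpP hq hpq (hpm x hx) _ _ (hRx x hx σ) (hm x hx) ?_
    have h2 : x ^ p - x ∈ P := by
      obtain ⟨t, ht⟩ := h1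
      have hp1 : p = q * t + 1 := by have := hp.one_lt; omega
      have h3 : x ^ p - x = ((m x : 𝓞 L) ^ t - 1) * x := by
        conv_lhs => rw [hp1]
        rw [pow_succ, pow_mul, hm x hx]; ring
      rw [h3]
      refine P.mul_mem_right _ ?_
      obtain ⟨y, hy⟩ := hpow x hx
      have hmx : (m x : ZMod p) ≠ 0 := by
        rw [Ne, ZMod.natCast_eq_zero_iff]; exact hpm x hx
      have hy0 : y ≠ 0 := by
        rintro rfl
        rw [zero_pow hq.ne_zero] at hy
        exact hmx hy.symm
      have h4 : (m x : ZMod p) ^ t = 1 := by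
        rw [← hy, ← pow_mul, ← ht]
        exact ZMod.pow_card_sub_one_eq_one hy0
      have h5 : (p : ℤ) ∣ (m x : ℤ) ^ t - 1 := by
        rw [← ZMod.intCast_eq_intCast_iff_dvd_sub 1 ((m x : ℤ) ^ t) p]
        push_cast
        exact h4.symm
      obtain ⟨c, hc⟩ := h5
      have h6 : (m x : 𝓞 L) ^ t - 1 = (p : 𝓞 L) * (c : 𝓞 L) := by
        have := congrArg (Int.cast : ℤ → 𝓞 L) hc
        push_cast at this
        exact this
      rw [h6]
      exact P.mul_mem_right _ hpP
    have := P.add_mem (hσ' x) h2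
    simpa using this
  have hfrob : ∀ x : 𝓞 L, x ^ p - x ∈ P := by
    intro x
    have := hσ' x
    rw [hsig, one_smul] at this
    have := P.neg_mem this
    simpa using this
  have := Fintype.ofFinite (𝓞 L ⧸ P)
  letI : Field (𝓞 L ⧸ P) := Ideal.Quotient.field P
  have hcard : Fintype.card (𝓞 L ⧸ P) = p := by
    have hch : CharP (𝓞 L ⧸ P) p := by
      refine (CharP.charP_iff_prime_eq_zero hp).2 ?_
      rw [← map_natCast (Ideal.Quotient.mk P), Ideal.Quotient.eq_zero_iff_mem]
      exact hpP
    obtain ⟨n, -, hn⟩ := FiniteField.card (𝓞 L ⧸ P) p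
    refine le_antisymm ?_ (by rw [hn]; exact Nat.le_self_pow n.ne_zero p)
    have hsub : (Finset.univ : Finset (𝓞 L ⧸ P)) ⊆
        (Polynomial.X ^ p - Polynomial.X : Polynomial (𝓞 L ⧸ P)).roots.toFinset := by
      intro z _
      obtain ⟨x, rfl⟩ := Ideal.Quotient.mk_surjective z
      rw [Multiset.mem_toFinset, Polynomial.mem_roots
        (FiniteField.X_pow_card_sub_X_ne_zero _ hp.one_lt)]
      simp only [Polynomial.IsRoot, Polynomial.eval_sub, Polynomial.eval_pow, Polynomial.eval_X]
      rw [← map_pow, ← map_sub, Ideal.Quotient.eq_zero_iff_mem]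
      exact hfrob x
    calc Fintype.card (𝓞 L ⧸ P) = (Finset.univ : Finset (𝓞 L ⧸ P)).card := rfl
      _ ≤ _ := Finset.card_le_card hsub
      _ ≤ _ := Multiset.toFinset_card_le _
      _ ≤ _ := Polynomial.card_roots' _
      _ = p := FiniteField.X_pow_card_sub_X_natDegree_eq _ hp.one_lt
  let e := ZMod.ringEquivOfPrime (𝓞 L ⧸ P) hp hcard
  let φ : 𝓞 L →+* ZMod p := e.symm.toRingHom.comp (Ideal.Quotient.mk P)
  have hφ : ∀ x, φ x = 0 → x ∈ P := by
    intro x hx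
    rw [← Ideal.Quotient.eq_zero_iff_mem]
    have : e.symm (Ideal.Quotient.mk P x) = 0 := hx
    simpa using this
  let Φ : (L ≃ₐ[ℚ] L) → (𝓞 L →+* ZMod p) := fun τ =>
    φ.comp (MulSemiringAction.toRingHom (L ≃ₐ[ℚ] L) (𝓞 L) τ)
  have hΦ : Function.Injective Φ := by
    intro τ τ' h
    refine hR τ τ' fun x hx => ?_
    refine aux_sep P p q (m x) hp hpP hq hpq (hpm x hx) _ _ (hRx x hx τ) (hRx x hx τ') ?_
    apply hφ
    rw [map_sub, sub_eq_zero]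
    exact DFunLike.congr_fun h x
  refine ⟨(Finset.univ : Finset (L ≃ₐ[ℚ] L)).image Φ, ?_⟩
  rw [Finset.card_image_of_injective _ hΦ, Finset.card_univ, ← Nat.card_eq_fintype_card,
    IsGalois.card_aut_eq_finrank]

end Frobenius

section Kummer
open NumberField

theorem aux_zpow {L : Type*} [Field L] (q : ℕ) [NeZero q] (ζ : L) (hζ : ζ ^ q = 1) (m : ℕ) :
    ζ ^ ((m : ZMod q)).val = ζ ^ m := by
  rw [ZMod.val_natCast]
  conv_rhs => rw [← Nat.mod_add_div m q, pow_add, pow_mul, hζ, one_pow, mul_one]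

theorem aux_prodval {n : ℕ} (p : Fin n → ℕ) (hp : ∀ i, (p i).Prime) (hinj : Function.Injective p)
    (v : Fin n → ℕ) (i : Fin n) :
    (∏ j, p j ^ v j).factorization (p i) = v i := by
  rw [Nat.factorization_prod_apply (fun j _ => pow_ne_zero _ (hp j).ne_zero)]
  rw [Finset.sum_eq_single i]
  · rw [(hp i).factorization_pow]; simp
  · intro j _ hj
    rw [(hp j).factorization_pow, Finsupp.single_eq_of_ne]
    intro h; exact hj (hinj h.symm)
  · simp

theorem aux_kummer_dvd {L : Type*} [Field L] [NumberField L] {n : ℕ} (q : ℕ) (hq : q.Prime)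
    (p : Fin n → ℕ) (hp : ∀ i, (p i).Prime) (hinj : Function.Injective p)
    (ζ : L) (hζ : IsPrimitiveRoot ζ q) (v : Fin n → ℕ) (y : L)
    (hy : y ^ q = ((∏ i, p i ^ v i : ℕ) : L)) (hyF : y ∈ IntermediateField.adjoin ℚ {ζ}) (i : Fin n) :
    q ∣ v i := by
  have hinteg : IsIntegral ℚ ζ := Algebra.IsIntegral.isIntegral ζ
  have hdeg : Module.finrank ℚ (IntermediateField.adjoin ℚ {ζ}) = q - 1 := by
    rw [IntermediateField.adjoin.finrank hinteg, ← Polynomial.cyclotomic_eq_minpoly_rat hζ hq.pos,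
      Polynomial.natDegree_cyclotomic, Nat.totient_prime hq]
  set F := IntermediateField.adjoin ℚ {ζ} with hF
  set M : ℕ := ∏ i, p i ^ v i with hM
  have hM0 : M ≠ 0 := Finset.prod_ne_zero_iff.2 fun j _ => pow_ne_zero _ (hp j).ne_zero
  let y' : F := ⟨y, hyF⟩
  have hy' : y' ^ q = algebraMap ℚ F (M : ℚ) := by
    apply Subtype.ext
    simpa [y'] using hy
  have hn := congrArg (Algebra.norm ℚ) hy'
  rw [map_pow, Algebra.norm_algebraMap, hdeg] at hn
  set t := Algebra.norm ℚ y'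
  have := Fact.mk (hp i)
  have ht0 : t ≠ 0 := by
    rintro h
    rw [h, zero_pow hq.ne_zero] at hn
    exact pow_ne_zero (q-1) (Nat.cast_ne_zero.2 hM0) hn.symm
  have h2 := congrArg (padicValRat (p i)) hn
  rw [padicValRat.pow, padicValRat.pow, padicValRat.of_nat, ← Nat.factorization_def _ (hp i),
    aux_prodval p hp hinj] at h2
  have h3 : (q : ℤ) ∣ ((q - 1 : ℕ) : ℤ) * (v i : ℤ) := ⟨_, h2.symm⟩
  rw [Nat.cast_sub hq.one_le] at h3
  have h4 : (q : ℤ) ∣ (v i : ℤ) := by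
    have h5 : (v i : ℤ) = q * v i - ((q : ℤ) - (1 : ℕ)) * v i := by push_cast; ring
    rw [h5]
    exact dvd_sub (dvd_mul_right _ _) h3
  exact_mod_cast h4

theorem aux_sigma {L : Type*} [Field L] [NumberField L] [IsGalois ℚ L] {n : ℕ} (q : ℕ)
    (hq : q.Prime)
    (p : Fin n → ℕ) (hp : ∀ i, (p i).Prime) (hinj : Function.Injective p)
    (ζ : L) (hζ : IsPrimitiveRoot ζ q) (α : Fin n → L) (hα : ∀ i, α i ^ q = (p i : L))
    (c : Fin n → ZMod q) :
    ∃ σ : L ≃ₐ[ℚ] L, σ ζ = ζ ∧ ∀ i, σ (α i) = ζ ^ (c i).val * α i := by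
  have := Fact.mk hq
  have hα0 : ∀ i, α i ≠ 0 := by
    intro i h
    have := hα i
    rw [h, zero_pow hq.ne_zero] at this
    exact (hp i).ne_zero (by exact_mod_cast this.symm)
  let H0 : AddSubmonoid (Fin n → ZMod q) :=
    { carrier := {d | ∃ σ : L ≃ₐ[ℚ] L, σ ζ = ζ ∧ ∀ i, σ (α i) = ζ ^ (d i).val * α i}
      zero_mem' := ⟨1, by simp⟩
      add_mem' := by
        rintro d e ⟨σ, hσ, hσ'⟩ ⟨τ, hτ, hτ'⟩
        refine ⟨σ * τ, by simp [hσ, hτ], fun i => ?_⟩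
        have h1 : ζ ^ ((d + e) i).val = ζ ^ ((d i).val + (e i).val) := by
          rw [← aux_zpow q ζ hζ.pow_eq_one ((d i).val + (e i).val)]
          simp
        rw [AlgEquiv.mul_apply, hτ', map_mul, map_pow, hσ, hσ', h1]
        ring }
  let H : Submodule (ZMod q) (Fin n → ZMod q) :=
    { H0 with
      smul_mem' := by
        intro r x hx
        have : r • x = r.val • x := by
          conv_lhs => rw [← ZMod.natCast_zmod_val r, Nat.cast_smul_eq_nsmul]
        rw [this]
        exact H0.nsmul_mem hx _ }
  by_contra hcon
  have hlt : H < ⊤ := by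
    rw [lt_top_iff_ne_top]
    intro h
    have : c ∈ H := by rw [h]; trivial
    exact hcon this
  obtain ⟨f, hf0, hf⟩ := Submodule.exists_le_ker_of_lt_top H hlt
  let v : Fin n → ℕ := fun i => (f (Pi.single i 1)).val
  have hfv : ∀ d : Fin n → ZMod q, f d = ((∑ i, (d i).val * v i : ℕ) : ZMod q) := by
    intro d
    conv_lhs => rw [← Finset.univ_sum_single d, map_sum]
    push_cast
    refine Finset.sum_congr rfl fun i _ => ?_
    have : (Pi.single i (d i) : Fin n → ZMod q) = d i • Pi.single i 1 := by
      rw [← Pi.single_smul]; simp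
    rw [this, map_smul]
    simp [v]
  have hmem : ∏ i, α i ^ v i ∈ IntermediateField.adjoin ℚ {ζ} := by
    rw [← IsGalois.fixedField_fixingSubgroup (IntermediateField.adjoin ℚ {ζ}),
      IntermediateField.mem_fixedField_iff]
    intro σ hσ
    rw [IntermediateField.mem_fixingSubgroup_iff] at hσ
    have hσζ : σ ζ = ζ := hσ ζ (IntermediateField.mem_adjoin_simple_self ℚ ζ)
    have h1 : ∀ i, ∃ j : ℕ, σ (α i) = ζ ^ j * α i := by
      intro i
      have : (σ (α i) / α i) ^ q = 1 := by
        rw [div_pow, ← map_pow, hα, map_natCast, div_self]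
        exact_mod_cast (hp i).ne_zero
      have hne : NeZero q := ⟨hq.ne_zero⟩
      obtain ⟨j, _, hj⟩ := hζ.eq_pow_of_pow_eq_one this
      exact ⟨j, by rw [hj, div_mul_cancel₀ _ (hα0 i)]⟩
    choose j hj using h1
    let d : Fin n → ZMod q := fun i => (j i : ZMod q)
    have hd : ∀ i, σ (α i) = ζ ^ (d i).val * α i := by
      intro i; rw [hj, aux_zpow q ζ hζ.pow_eq_one]
    have hdH : d ∈ H := ⟨σ, hσζ, hd⟩
    have hfd : f d = 0 := hf hdH
    rw [hfv] at hfd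
    have h2 : ζ ^ (∑ i, (d i).val * v i) = 1 := by
      rw [← aux_zpow q ζ hζ.pow_eq_one, hfd]; simp
    rw [map_prod]
    have h3 : ∀ i, σ (α i ^ v i) = ζ ^ ((d i).val * v i) * α i ^ v i := by
      intro i; rw [map_pow, hd, mul_pow, pow_mul]
    rw [Finset.prod_congr rfl (fun i _ => h3 i), Finset.prod_mul_distrib, Finset.prod_pow_eq_pow_sum,
      h2, one_mul]
  have hpow : (∏ i, α i ^ v i) ^ q = ((∏ i, p i ^ v i : ℕ) : L) := by
    rw [← Finset.prod_pow]
    push_cast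
    refine Finset.prod_congr rfl fun i _ => ?_
    rw [← pow_mul, mul_comm, pow_mul, hα]
  have hdv := aux_kummer_dvd q hq p hp hinj ζ hζ v _ hpow hmem
  apply hf0
  refine LinearMap.ext fun d => ?_
  rw [hfv, LinearMap.zero_apply, Nat.cast_sum]
  refine Finset.sum_eq_zero fun i _ => ?_
  rw [Nat.cast_mul, (ZMod.natCast_eq_zero_iff (v i) q).2 (hdv i), mul_zero]

end Kummer

section Cheb
open NumberField Polynomial

theorem aux_split (L : Type) [Field L] [CharZero L] {n : ℕ} (q : ℕ) (hq : q.Prime)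
    (p : Fin n → ℕ) (f : ℚ[X]) (hf : f = cyclotomic q ℚ * ∏ i, (X ^ q - C (p i : ℚ)))
    [hS : IsSplittingField ℚ L f] :
    ∃ (_ : NumberField L) (_ : IsGalois ℚ L) (ζ : L) (α : Fin n → L),
      IsPrimitiveRoot ζ q ∧ (∀ i, α i ^ q = (p i : L)) ∧
      Algebra.adjoin ℚ {x : L | x ^ q = 1 ∨ ∃ i, x ^ q = (p i : L)} = ⊤ := by
  have hf0 : f ≠ 0 := by
    rw [hf]
    refine mul_ne_zero (cyclotomic_ne_zero q ℚ) (Finset.prod_ne_zero_iff.2 fun i _ => ?_)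
    exact X_pow_sub_C_ne_zero hq.pos _
  have hn : Normal ℚ L := Normal.of_isSplittingField f
  have hfd : FiniteDimensional ℚ L := IsSplittingField.finiteDimensional L f
  have hG : IsGalois ℚ L := { }
  have hN : NumberField L := { }
  have hs : (f.map (algebraMap ℚ L)).Splits := IsSplittingField.splits L f
  have hroot : ∀ g : ℚ[X], g ∣ f → g.degree ≠ 0 → ∃ x : L, aeval x g = 0 := by
    intro g hg hd
    have h1 : (g.map (algebraMap ℚ L)).Splits :=
      hs.of_dvd (map_ne_zero hf0) (Polynomial.map_dvd _ hg)
    obtain ⟨x, hx⟩ := h1.exists_eval_eq_zero (by rwa [degree_map])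
    exact ⟨x, by rwa [eval_map_algebraMap] at hx⟩
  obtain ⟨ζ, hζ⟩ := hroot (cyclotomic q ℚ) (hf ▸ dvd_mul_right _ _)
    (by
      have := degree_cyclotomic_pos q ℚ hq.pos
      exact this.ne')
  have hα : ∀ i, ∃ x : L, x ^ q = (p i : L) := by
    intro i
    obtain ⟨x, hx⟩ := hroot (X ^ q - C (p i : ℚ))
      (by
        rw [hf]
        exact (Finset.dvd_prod_of_mem (fun i => X ^ q - C (p i : ℚ)) (Finset.mem_univ i)).trans
          (dvd_mul_left _ _))
      (by rw [degree_X_pow_sub_C hq.pos]; exact_mod_cast hq.ne_zero)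
    refine ⟨x, ?_⟩
    simpa [sub_eq_zero] using hx
  choose α hα using hα
  have hnz : NeZero ((q : ℕ) : L) := ⟨by exact_mod_cast hq.ne_zero⟩
  refine ⟨hN, hG, ζ, α, ?_, hα, ?_⟩
  · rw [← isRoot_cyclotomic_iff]
    rw [IsRoot, ← map_cyclotomic q (algebraMap ℚ L), eval_map_algebraMap]
    exact hζ
  · rw [eq_top_iff, ← IsSplittingField.adjoin_rootSet L f]
    apply Algebra.adjoin_mono
    intro x hx
    rw [mem_rootSet] at hx
    have h2 := hx.2
    simp only [hf, map_mul, map_prod] at h2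
    rcases mul_eq_zero.1 h2 with h | h
    · left
      obtain ⟨g, hg⟩ := cyclotomic.dvd_X_pow_sub_one q ℚ
      have := congrArg (aeval x) hg
      rw [map_mul, h, zero_mul] at this
      simpa [sub_eq_zero] using this
    · right
      obtain ⟨i, _, hi⟩ := Finset.prod_eq_zero_iff.1 h
      exact ⟨i, by simpa [sub_eq_zero] using hi⟩

theorem aux_exists_L {n : ℕ} (q : ℕ) (hq : q.Prime) (p : Fin n → ℕ) :
    ∃ (L : Type) (_ : Field L) (_ : NumberField L) (_ : IsGalois ℚ L) (ζ : L) (α : Fin n → L),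
      IsPrimitiveRoot ζ q ∧ (∀ i, α i ^ q = (p i : L)) ∧
      Algebra.adjoin ℚ {x : L | x ^ q = 1 ∨ ∃ i, x ^ q = (p i : L)} = ⊤ := by
  obtain ⟨f, hf⟩ : ∃ f : ℚ[X], f = cyclotomic q ℚ * ∏ i, (X ^ q - C (p i : ℚ)) := ⟨_, rfl⟩
  have hcz : CharZero f.SplittingField := algebraRat.charZero _
  have hS : @IsSplittingField ℚ f.SplittingField _ _ DivisionRing.toRatAlgebra f := by
    have h := IsSplittingField.splittingField f
    convert h
    exact Subsingleton.elim _ _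
  obtain ⟨a, b, h⟩ := aux_split f.SplittingField q hq p f hf
  exact ⟨_, _, a, b, h⟩

theorem aux_cheb {n : ℕ} (q : ℕ) (hq : q.Prime) (p : Fin n → ℕ) (hp : ∀ i, (p i).Prime)
    (hinj : Function.Injective p) (c : Fin n → ZMod q) (Δ : ℕ) (hΔ : 0 < Δ) :
    ∃ l : ℕ, l.Prime ∧ ¬ l ∣ Δ ∧ ∀ v : Fin n → ℕ,
      (∃ x : ZMod l, x ^ q = ((∏ i, p i ^ v i : ℕ) : ZMod l)) →
      ∑ i, c i * (v i : ZMod q) = 0 := by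
  classical
  have := Fact.mk hq
  by_cases hc : c = 0
  · obtain ⟨l, hl, hlp⟩ := Nat.exists_infinite_primes (Δ + 1)
    refine ⟨l, hlp, fun h => ?_, fun v _ => by simp [hc]⟩
    have := Nat.le_of_dvd hΔ h
    omega
  obtain ⟨i0, hi0⟩ : ∃ i, c i ≠ 0 := by
    by_contra! h
    exact hc (funext h)
  by_contra! hcon
  obtain ⟨L, _, _, _, ζ, α, hζ, hα, htop⟩ := aux_exists_L q hq p
  obtain ⟨σ, hσζ, hσ⟩ := aux_sigma q hq p hp hinj ζ hζ α hα c
  let K : IntermediateField ℚ L := IntermediateField.fixedField (Subgroup.zpowers σ)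
  have hK : ∀ x : L, σ x = x → x ∈ K := by
    intro x hx
    rw [IntermediateField.mem_fixedField_iff]
    intro τ hτ
    obtain ⟨z, rfl⟩ := Subgroup.mem_zpowers_iff.1 hτ
    have : σ ∈ MulAction.stabilizer (L ≃ₐ[ℚ] L) x := hx
    exact Subgroup.zpow_mem _ this z
  have hα0 : ∀ i, α i ≠ 0 := by
    intro i h
    have := hα i
    rw [h, zero_pow hq.ne_zero] at this
    exact (hp i).ne_zero (by exact_mod_cast this.symm)
  have hKtop : K ≠ ⊤ := by
    intro h
    have h1 : α i0 ∈ K := by rw [h]; trivial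
    have h2 : σ (α i0) = α i0 :=
      (IntermediateField.mem_fixedField_iff _ _).1 h1 σ (Subgroup.mem_zpowers σ)
    rw [hσ] at h2
    have h3 : ζ ^ (c i0).val = 1 := by
      have := mul_right_cancel₀ (hα0 i0) (h2.trans (one_mul _).symm)
      exact this
    have h4 := (hζ.pow_eq_one_iff_dvd _).1 h3
    have h5 := Nat.eq_zero_of_dvd_of_lt h4 (ZMod.val_lt _)
    exact hi0 ((ZMod.val_eq_zero _).1 h5)
  have hlt : Module.finrank ℚ K < Module.finrank ℚ L := by
    have : K.toSubalgebra.toSubmodule < ⊤ := by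
      rw [lt_top_iff_ne_top]
      intro h
      apply hKtop
      rw [eq_top_iff]
      intro x _
      have : x ∈ K.toSubalgebra.toSubmodule := by rw [h]; trivial
      exact this
    exact Submodule.finrank_lt this.ne
  have hNK : NumberField K := inferInstance
  -- integral elements of K
  have hinteg : ∀ (x : L) (m : ℕ), x ^ q = m → x ∈ K → ∃ y : 𝓞 K, ((y : K) : L) = x := by
    intro x m hx hxK
    have : IsIntegral ℤ (⟨x, hxK⟩ : K) := by
      refine IsIntegral.of_pow hq.pos ?_
      have : (⟨x, hxK⟩ : K) ^ q = ((m : ℤ) : K) := by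
        apply Subtype.ext
        push_cast
        exact hx
      rw [this]
      exact isIntegral_algebraMap
    exact ⟨⟨_, this⟩, rfl⟩
  have hZ : q * Δ * ∏ i, p i ≠ 0 :=
    mul_ne_zero (mul_ne_zero hq.ne_zero hΔ.ne')
      (Finset.prod_ne_zero_iff.2 fun i _ => (hp i).ne_zero)
  refine aux_density K L hlt {l | q ∣ l - 1 ∧ ∀ i, ∃ y : ZMod l, y ^ q = (p i : ZMod l)}
    (q * Δ * ∏ i, p i).primeFactors ?_ ?_
  · rintro l hl hlX ⟨φ⟩
    have := Fact.mk hl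
    have hlZ : ¬ l ∣ q * Δ * ∏ i, p i := fun h => hlX (Nat.mem_primeFactors.2 ⟨hl, h, hZ⟩)
    have hlp : ∀ i, (p i : ZMod l) ≠ 0 := by
      intro i h
      rw [ZMod.natCast_eq_zero_iff] at h
      exact hlZ ((h.trans (Finset.dvd_prod_of_mem p (Finset.mem_univ i))).trans (dvd_mul_left _ _))
    have hlq : (q : ZMod l) ≠ 0 := by
      intro h
      rw [ZMod.natCast_eq_zero_iff] at h
      exact hlZ ((h.trans (dvd_mul_right _ _)).trans (dvd_mul_right _ _))
    have hlΔ : ¬ l ∣ Δ := fun h => hlZ ((h.trans (dvd_mul_left _ _)).trans (dvd_mul_right _ _))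
    have hpw : ∀ w : Fin n → ℕ, ∑ i, c i * (w i : ZMod q) = 0 →
        ∃ x : ZMod l, x ^ q = ((∏ i, p i ^ w i : ℕ) : ZMod l) := by
      intro w hw
      have h1 : σ (∏ i, α i ^ w i) = ∏ i, α i ^ w i := by
        rw [map_prod]
        have h3 : ∀ i, σ (α i ^ w i) = ζ ^ ((c i).val * w i) * α i ^ w i := by
          intro i; rw [map_pow, hσ, mul_pow, pow_mul]
        have h2 : ζ ^ (∑ i, (c i).val * w i) = 1 := by
          rw [← aux_zpow q ζ hζ.pow_eq_one]
          push_cast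
          simp only [ZMod.natCast_val, ZMod.cast_id', id]
          rw [hw]; simp
        rw [Finset.prod_congr rfl (fun i _ => h3 i), Finset.prod_mul_distrib,
          Finset.prod_pow_eq_pow_sum, h2, one_mul]
      have hpow : (∏ i, α i ^ w i) ^ q = ((∏ i, p i ^ w i : ℕ) : L) := by
        rw [← Finset.prod_pow]
        push_cast
        refine Finset.prod_congr rfl fun i _ => ?_
        rw [← pow_mul, mul_comm, pow_mul, hα]
      obtain ⟨y, hy⟩ := hinteg _ _ hpow (hK _ h1)
      have hy2 : y ^ q = ((∏ i, p i ^ w i : ℕ) : 𝓞 K) := by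
        apply RingOfIntegers.ext
        apply Subtype.ext
        have : (((y ^ q : 𝓞 K) : K) : L) = (∏ i, α i ^ w i) ^ q := by
          rw [← hy]; simp
        rw [this, hpow]
        simp
      exact ⟨φ y, by rw [← map_pow, hy2, map_natCast]⟩
    refine ⟨?_, fun i => ?_⟩
    · obtain ⟨y, hy⟩ := hinteg ζ 1 (by rw [hζ.pow_eq_one]; simp) (hK _ hσζ)
      have hinjL : Function.Injective (fun z : 𝓞 K => ((z : K) : L)) := by
        intro a b hab
        exact RingOfIntegers.ext (Subtype.ext hab)
      have hy1 : y ^ q = 1 := by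
        apply hinjL
        simp [hy, hζ.pow_eq_one]
      have hy2 : ∑ i ∈ range q, y ^ i = 0 := by
        apply hinjL
        have := hζ.geom_sum_eq_zero hq.one_lt
        simp [hy, this]
      have hne : φ y ≠ 1 := by
        intro h
        have h6 := congrArg φ hy2
        rw [map_sum, map_zero] at h6
        simp only [map_pow, h, one_pow, Finset.sum_const, card_range, nsmul_eq_mul, mul_one] at h6
        exact hlq h6
      have hφ1 : φ y ^ q = 1 := by rw [← map_pow, hy1, map_one]
      have hord : orderOf (φ y) = q := orderOf_eq_prime hφ1 hne
      rw [← hord]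
      apply ZMod.orderOf_dvd_card_sub_one
      intro h
      rw [h, zero_pow hq.ne_zero] at hφ1
      exact zero_ne_one hφ1
    · obtain ⟨v, ⟨x, hx⟩, hv⟩ := hcon l hl hlΔ
      set s := ∑ i, c i * (v i : ZMod q) with hs
      let t : ZMod q := - c i / s
      obtain ⟨y, hy⟩ := hpw (fun j => (if j = i then 1 else 0) + t.val * v j) (by
        have : ∀ j, c j * (((if j = i then 1 else 0) + t.val * v j : ℕ) : ZMod q) =
            (if j = i then c j else 0) + t * (c j * (v j : ZMod q)) := by
          intro j
          push_cast
          simp only [ZMod.natCast_val, ZMod.cast_id', id]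
          split_ifs <;> ring
        rw [Finset.sum_congr rfl (fun j _ => this j), Finset.sum_add_distrib, ← Finset.mul_sum, ← hs]
        simp only [Finset.sum_ite_eq', Finset.mem_univ, if_true, t]
        field_simp
        ring)
      have hx0 : x ≠ 0 := by
        intro h
        rw [h, zero_pow hq.ne_zero] at hx
        push_cast at hx
        have := Finset.prod_eq_zero_iff.1 hx.symm
        obtain ⟨j, _, hj⟩ := this
        exact hlp j (eq_zero_of_pow_eq_zero hj)
      refine ⟨y / x ^ t.val, ?_⟩
      rw [div_pow, hy, ← pow_mul, mul_comm t.val q, pow_mul, hx, div_eq_iff]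
      · push_cast
        simp_rw [pow_add, Finset.prod_mul_distrib]
        congr 1
        · simp [Finset.prod_ite_eq']
        · rw [← Finset.prod_pow]
          refine Finset.prod_congr rfl fun j _ => ?_
          rw [← pow_mul, mul_comm]
      · rw [← hx]
        exact pow_ne_zero _ (pow_ne_zero _ hx0)
  · rintro l hl hlX ⟨hl1, hl2⟩
    have hlZ : ¬ l ∣ q * Δ * ∏ i, p i := fun h => hlX (Nat.mem_primeFactors.2 ⟨hl, h, hZ⟩)
    have hm : ∀ x : 𝓞 L, ∃ m : ℕ, (x ^ q = 1 ∨ ∃ i, x ^ q = (p i : 𝓞 L)) →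
        x ^ q = (m : 𝓞 L) ∧ (m = 1 ∨ ∃ i, m = p i) := by
      intro x
      by_cases h : x ^ q = 1 ∨ ∃ i, x ^ q = (p i : 𝓞 L)
      · rcases h with h | ⟨i, h⟩
        · exact ⟨1, fun _ => ⟨by simpa using h, Or.inl rfl⟩⟩
        · exact ⟨p i, fun _ => ⟨h, Or.inr ⟨i, rfl⟩⟩⟩
      · exact ⟨0, fun h' => (h h').elim⟩
    choose m hm using hm
    refine aux_homs L q hq {x : 𝓞 L | x ^ q = 1 ∨ ∃ i, x ^ q = (p i : 𝓞 L)} ?_ m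
      (fun x hx => (hm x hx).1) l hl ?_ ?_ hl1 ?_
    · intro τ ρ h
      have : (τ : L →ₐ[ℚ] L) = ρ := by
        refine AlgHom.ext_of_adjoin_eq_top htop ?_
        intro x hx
        have hxi : IsIntegral ℤ x := by
          refine IsIntegral.of_pow hq.pos ?_
          rcases hx with hx | ⟨i, hx⟩
          · rw [hx]; exact isIntegral_one
          · rw [hx]; exact_mod_cast (isIntegral_algebraMap (R := ℤ) (A := L) (x := (p i : ℤ)))
        have := h ⟨x, hxi⟩ (by
          rcases hx with hx | ⟨i, hx⟩
          · left; exact RingOfIntegers.ext (hx : _)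
          · right; exact ⟨i, RingOfIntegers.ext (hx.trans (map_natCast (algebraMap (𝓞 L) L) (p i)).symm)⟩)
        exact congrArg (fun z : 𝓞 L => (z : L)) this
      exact AlgEquiv.coe_toAlgHom_injective this
    · rintro rfl
      exact hlZ ((dvd_mul_right _ _).trans (dvd_mul_right _ _))
    · intro x hx h
      rcases (hm x hx).2 with h1 | ⟨i, h1⟩
      · rw [h1] at h; exact hl.one_lt.ne' (Nat.dvd_one.1 h)
      · rw [h1] at h
        exact hlZ ((h.trans (Finset.dvd_prod_of_mem p (Finset.mem_univ i))).trans (dvd_mul_left _ _))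
    · intro x hx
      rcases (hm x hx).2 with h1 | ⟨i, h1⟩
      · exact ⟨1, by rw [h1]; simp⟩
      · rw [h1]; exact hl2 i

end Cheb

section Combi

def AuxCyc (k : ℕ) (x y z : Fin (k + 2)) : Prop :=
  (x = 0 ∧ y = 1 ∧ z = 2) ∨ (x = 1 ∧ y = 2 ∧ z = 0) ∨ (x = 2 ∧ y = 0 ∧ z = 1)

def AuxTri (q k : ℕ) (x y z : Fin (k + 2)) (e : Fin (k + 2) → ℕ) : Prop :=
  e x = 0 ∧ e y = 1 ∧ (∃ s ∈ Q0 q, e z = q - ZMod.val s) ∧ ∀ i : Fin (k + 2), 3 ≤ (i : ℕ) → e i ≤ q - 1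

def AuxD (q k : ℕ) (j : Fin (k + 2)) (e : Fin (k + 2) → ℕ) : Prop :=
  e j = 1 ∧ (∀ i, i < j → e i = 0) ∧ (∀ i, j < i → e i ≤ q - 1)

def AuxIn (q k : ℕ) (e : Fin (k + 2) → ℕ) : Prop :=
  (∃ x y z, AuxCyc k x y z ∧ AuxTri q k x y z e) ∨ (∃ j : Fin (k + 2), 3 ≤ (j : ℕ) ∧ AuxD q k j e)

theorem aux_vals {k : ℕ} (hk : 2 ≤ k) :
    ((0 : Fin (k + 2)) : ℕ) = 0 ∧ ((1 : Fin (k + 2)) : ℕ) = 1 ∧ ((2 : Fin (k + 2)) : ℕ) = 2 :=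
  ⟨rfl, Nat.mod_eq_of_lt (show 1 < k + 2 by omega), Nat.mod_eq_of_lt (show 2 < k + 2 by omega)⟩

theorem AuxCyc.props {k : ℕ} (hk : 2 ≤ k) {x y z : Fin (k + 2)} (h : AuxCyc k x y z) :
    x ≠ y ∧ y ≠ z ∧ x ≠ z ∧ (x : ℕ) < 3 ∧ (y : ℕ) < 3 ∧ (z : ℕ) < 3 ∧
      ∀ i : Fin (k + 2), (i : ℕ) < 3 → i = x ∨ i = y ∨ i = z := by
  obtain ⟨h0, h1, h2⟩ := aux_vals hk
  simp only [Fin.ext_iff, ne_eq]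
  rcases h with ⟨rfl, rfl, rfl⟩ | ⟨rfl, rfl, rfl⟩ | ⟨rfl, rfl, rfl⟩ <;>
    rw [h0, h1, h2] <;> refine ⟨by omega, by omega, by omega, by omega, by omega, by omega, ?_⟩ <;>
    intro i hi <;> omega

theorem AuxCyc.rot {k : ℕ} {x y z : Fin (k + 2)} (h : AuxCyc k x y z) : AuxCyc k y z x := by
  unfold AuxCyc at *; tauto

theorem AuxCyc.cases {k : ℕ} (hk : 2 ≤ k) {x y z x' y' z' : Fin (k + 2)} (h : AuxCyc k x y z)
    (h' : AuxCyc k x' y' z') : (x' = x ∧ y' = y ∧ z' = z) ∨ (x' = y ∧ y' = z ∧ z' = x) ∨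
      (x' = z ∧ y' = x ∧ z' = y) := by
  unfold AuxCyc at *
  rcases h with ⟨rfl, rfl, rfl⟩ | ⟨rfl, rfl, rfl⟩ | ⟨rfl, rfl, rfl⟩ <;>
  rcases h' with ⟨rfl, rfl, rfl⟩ | ⟨rfl, rfl, rfl⟩ | ⟨rfl, rfl, rfl⟩ <;> simp

theorem aux_Q0 (q : ℕ) (x : ZMod q) : x ∈ Q0 q ↔ IsSquare x := by
  unfold Q0
  constructor
  · rintro (⟨a, _, rfl⟩ | rfl)
    · exact ⟨a, sq a⟩
    · exact ⟨0, by simp⟩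
  · rintro ⟨a, rfl⟩
    by_cases h : a = 0
    · right; simp [h]
    · left; exact ⟨a, h, sq a⟩

theorem aux_neg_cast {q : ℕ} [NeZero q] (s : ZMod q) : ((q - s.val : ℕ) : ZMod q) = -s := by
  rw [Nat.cast_sub (ZMod.val_lt s).le]
  simp

theorem aux_le_eq {q a b : ℕ} (hq : 0 < q) (ha : a ≤ q - 1) (hb : b ≤ q - 1)
    (h : (a : ZMod q) = b) : a = b := by
  rw [ZMod.natCast_eq_natCast_iff'] at h
  rwa [Nat.mod_eq_of_lt (by omega), Nat.mod_eq_of_lt (by omega)] at h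

theorem aux_fin_ge {k : ℕ} {i j : Fin (k + 2)} (hj : 3 ≤ (j : ℕ)) (hi : (i : ℕ) < 3) : i < j := by
  rw [Fin.lt_def]; omega

theorem aux_unique {q k : ℕ} (hq : q.Prime) (hk : 2 ≤ k) {e e' : Fin (k + 2) → ℕ}
    (h : AuxIn q k e) (h' : AuxIn q k e') (hee : ∀ i, (e i : ZMod q) = e' i) : e = e' := by
  have := Fact.mk hq
  have key : ∀ i, e i = 1 → e' i = 0 → False := by
    intro i h1 h2
    have := hee i
    rw [h1, h2] at this
    simp at this
  have key' : ∀ i, e i = 0 → e' i = 1 → False := by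
    intro i h1 h2
    have := hee i
    rw [h1, h2] at this
    simp at this
  rcases h with ⟨x, y, z, hc, h1, h2, ⟨s, hs, h3⟩, h4⟩ | ⟨j, hj, h1, h2, h3⟩
  · obtain ⟨-, -, -, hx3, hy3, hz3, hall⟩ := hc.props hk
    rcases h' with ⟨x', y', z', hc', h1', h2', ⟨s', hs', h3'⟩, h4'⟩ | ⟨j', hj', h1', h2', h3'⟩
    · rcases hc.cases hk hc' with ⟨rfl, rfl, rfl⟩ | ⟨rfl, rfl, rfl⟩ | ⟨rfl, rfl, rfl⟩
      · funext i
        by_cases hi : 3 ≤ (i : ℕ)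
        · exact aux_le_eq hq.pos (h4 i hi) (h4' i hi) (hee i)
        · rcases hall i (by omega) with rfl | rfl | rfl
          · rw [h1, h1']
          · rw [h2, h2']
          · have := hee i
            rw [h3, h3', aux_neg_cast, aux_neg_cast, neg_inj] at this
            rw [h3, h3', this]
      · exact (key _ h2 h1').elim
      · exact (key' _ h1 h2').elim
    · exact (key y h2 (h2' y (aux_fin_ge hj' hy3))).elim
  · rcases h' with ⟨x', y', z', hc', h1', h2', ⟨s', hs', h3'⟩, h4'⟩ | ⟨j', hj', h1', h2', h3'⟩
    · exact (key' y' (h2 y' (aux_fin_ge hj (hc'.props hk).2.2.2.2.1)) h2').elim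
    · rcases lt_trichotomy j j' with hlt | rfl | hlt
      · exact (key j h1 (h2' j hlt)).elim
      · funext i
        rcases lt_trichotomy i j with hi | rfl | hi
        · rw [h2 i hi, h2' i hi]
        · rw [h1, h1']
        · exact aux_le_eq hq.pos (h3 i hi) (h3' i hi) (hee i)
      · exact (key' j' (h2 j' hlt) h1').elim

theorem aux_has_one {q k : ℕ} {e : Fin (k + 2) → ℕ} (h : AuxIn q k e) : ∃ i, e i = 1 := by
  rcases h with ⟨x, y, z, hc, h1, h2, h3⟩ | ⟨j, hj, h1, h2⟩
  · exact ⟨y, h2⟩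
  · exact ⟨j, h1⟩

/-- closing lemma for the triangle -/
theorem aux_close_tri {q k : ℕ} (hq : q.Prime) (hk : 2 ≤ k) {x y z : Fin (k + 2)}
    (hc : AuxCyc k x y z) (w : Fin (k + 2) → ZMod q) (hx : w x = 0) (hy : w y = 1) (s : ZMod q)
    (hs : s ∈ Q0 q) (hz : w z = -s) :
    ∃ e, AuxIn q k e ∧ (fun i => (e i : ZMod q)) = w := by
  classical
  have := Fact.mk hq
  obtain ⟨hxy, hyz, hxz, hx3, hy3, hz3, hall⟩ := hc.props hk
  refine ⟨fun i => if i = z then q - s.val else (w i).val, Or.inl ⟨x, y, z, hc, ?_, ?_, ⟨s, hs, ?_⟩, ?_⟩, ?_⟩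
  · simp [hxz, hx]
  · simp [hyz, hy, ZMod.val_one]
  · simp
  · intro i hi
    have : i ≠ z := by rintro rfl; omega
    simp only [this, if_false]
    have := ZMod.val_lt (w i)
    omega
  · funext i
    by_cases hi : i = z
    · subst hi; simp only [if_true]; rw [aux_neg_cast, hz]
    · simp [hi]

theorem aux_close_D {q k : ℕ} (hq : q.Prime) (j : Fin (k + 2)) (hj : 3 ≤ (j : ℕ))
    (w : Fin (k + 2) → ZMod q) (h1 : w j = 1) (h2 : ∀ i, i < j → w i = 0) :
    ∃ e, AuxIn q k e ∧ (fun i => (e i : ZMod q)) = w := by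
  have := Fact.mk hq
  refine ⟨fun i => (w i).val, Or.inr ⟨j, hj, ?_, ?_, ?_⟩, ?_⟩
  · simp [h1, ZMod.val_one]
  · intro i hi; simp [h2 i hi]
  · intro i _
    have := ZMod.val_lt (w i)
    show (w i).val ≤ _
    omega
  · funext i; simp

theorem aux_step {q k : ℕ} (hq : q.Prime) (hk : 2 ≤ k)
    (W : Submodule (ZMod q) (Fin (k + 2) → ZMod q)) {x y z : Fin (k + 2)}
    (hc : AuxCyc k x y z) (hW : ∃ w ∈ W, w ≠ 0 ∧ w x = 0) :
    (∃ e, AuxIn q k e ∧ (fun i => (e i : ZMod q)) ∈ W) ∨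
      ∃ w ∈ W, ∃ s, w x = 0 ∧ w y = 1 ∧ w z = -s ∧ ¬ IsSquare s := by
  classical
  have := Fact.mk hq
  obtain ⟨w, hw, hw0, hwx⟩ := hW
  obtain ⟨hxy, hyz, hxz, hx3, hy3, hz3, hall⟩ := hc.props hk
  by_cases hy : w y = 0
  · left
    by_cases hz : w z = 0
    · -- D type
      have hex : (Finset.univ.filter (fun i => w i ≠ 0)).Nonempty := by
        by_contra h
        rw [Finset.not_nonempty_iff_eq_empty, Finset.filter_eq_empty_iff] at h
        apply hw0
        funext i
        have := h (Finset.mem_univ i)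
        simpa using this
      set j := (Finset.univ.filter (fun i => w i ≠ 0)).min' hex with hj
      have hj1 : w j ≠ 0 := by
        have := Finset.min'_mem _ hex
        rw [← hj, Finset.mem_filter] at this
        exact this.2
      have hj2 : ∀ i, i < j → w i = 0 := by
        intro i hi
        by_contra h
        have := Finset.min'_le (Finset.univ.filter (fun i => w i ≠ 0)) i (by simp [h])
        rw [← hj] at this
        exact absurd hi (not_lt.2 this)
      have hj3 : 3 ≤ (j : ℕ) := by
        by_contra h
        rcases hall j (by omega) with h | h | h <;> rw [h] at hj1 <;> contradiction
      obtain ⟨e, he, he'⟩ := aux_close_D hq j hj3 ((w j)⁻¹ • w) (by simp [hj1])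
        (fun i hi => by simp [hj2 i hi])
      exact ⟨e, he, he' ▸ W.smul_mem _ hw⟩
    · obtain ⟨e, he, he'⟩ := aux_close_tri hq hk hc.rot ((w z)⁻¹ • w) (by simp [hy])
        (by simp [hz]) 0 (Or.inr rfl) (by simp [hwx])
      exact ⟨e, he, he' ▸ W.smul_mem _ hw⟩
  · by_cases hs : IsSquare (-((w y)⁻¹ * w z))
    · left
      obtain ⟨e, he, he'⟩ := aux_close_tri hq hk hc ((w y)⁻¹ • w) (by simp [hwx])
        (by simp [hy]) (-((w y)⁻¹ * w z)) ((aux_Q0 q _).2 hs) (by simp)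
      exact ⟨e, he, he' ▸ W.smul_mem _ hw⟩
    · right
      exact ⟨(w y)⁻¹ • w, W.smul_mem _ hw, _, by simp [hwx], by simp [hy], by simp, hs⟩

theorem aux_blocking {q k : ℕ} (hq : q.Prime) (hodd : Odd q) (hk : 2 ≤ k)
    (W : Submodule (ZMod q) (Fin (k + 2) → ZMod q))
    (hW : ∀ x, ∃ w ∈ W, w ≠ 0 ∧ w x = 0) :
    ∃ e, AuxIn q k e ∧ (fun i => (e i : ZMod q)) ∈ W := by
  classical
  have := Fact.mk hq
  have hA : AuxCyc k 0 1 2 := Or.inl ⟨rfl, rfl, rfl⟩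
  rcases aux_step hq hk W hA (hW _) with h | ⟨w1, hw1, α, h10, h11, h12, hα⟩
  · exact h
  rcases aux_step hq hk W hA.rot (hW _) with h | ⟨w2, hw2, β, h21, h22, h20, hβ⟩
  · exact h
  rcases aux_step hq hk W hA.rot.rot (hW _) with h | ⟨w3, hw3, γ, h32, h30, h31, hγ⟩
  · exact h
  have hne : 1 - α * β * γ ≠ 0 := by
    intro h
    have h1 : α * β * γ = 1 := by linear_combination -h
    have hc : ringChar (ZMod q) ≠ 2 := by
      rw [ZMod.ringChar_zmod_n]
      rintro rfl
      exact absurd hodd (by decide)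
    have h2 := congrArg (quadraticChar (ZMod q)) h1
    rw [map_mul, map_mul, map_one, (quadraticChar_neg_one_iff_not_isSquare).2 hα,
      (quadraticChar_neg_one_iff_not_isSquare).2 hβ,
      (quadraticChar_neg_one_iff_not_isSquare).2 hγ] at h2
    norm_num at h2
  have hw : (1 - α * β * γ)⁻¹ • (w2 + β • w3 + (β * γ) • w1) ∈ W :=
    W.smul_mem _ (W.add_mem (W.add_mem hw2 (W.smul_mem _ hw3)) (W.smul_mem _ hw1))
  obtain ⟨e, he, he'⟩ := aux_close_tri hq hk hA.rot
    ((1 - α * β * γ)⁻¹ • (w2 + β • w3 + (β * γ) • w1))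
    (by simp [h21, h31, h11])
    (by
      simp only [Pi.smul_apply, Pi.add_apply, h22, h32, h12, smul_eq_mul]
      rw [inv_mul_eq_div, div_eq_one_iff_eq hne]; ring)
    0 (Or.inr rfl) (by simp [h20, h30, h10])
  exact ⟨e, he, he' ▸ hw⟩

/-- few functionals have a common nonzero zero -/
theorem aux_common {q n : ℕ} (hq : q.Prime) {ι : Type*} (I : Finset ι) (hI : I.card + 1 < n)
    (a : ι → Fin n → ZMod q) (x : Fin n) :
    ∃ w : Fin n → ZMod q, (∀ l ∈ I, ∑ i, a l i * w i = 0) ∧ w ≠ 0 ∧ w x = 0 := by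
  have := Fact.mk hq
  let φ : (Fin n → ZMod q) →ₗ[ZMod q] ((I → ZMod q) × ZMod q) :=
    (LinearMap.pi fun l : I => (Fintype.linearCombination (ZMod q) (a l.1))).prod (LinearMap.proj x)
  have h := LinearMap.ker_ne_bot_of_finrank_lt (f := φ) (by simpa using hI)
  obtain ⟨w, hw, hw0⟩ := (Submodule.ne_bot_iff _).1 h
  rw [LinearMap.mem_ker] at hw
  refine ⟨w, fun l hl => ?_, hw0, ?_⟩
  · have := congrFun (congrArg Prod.fst hw) ⟨l, hl⟩
    simpa [φ, Fintype.linearCombination_apply, mul_comm] using this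
  · exact congrArg Prod.snd hw

end Combi

section Final

/-- characterization of the set via exponents -/
theorem aux_second {q k : ℕ} (hk : 2 ≤ k) (p : Fin (k + 2) → ℕ) (m : ℤ) :
    m ∈ secondSet q k p ↔ ∃ e, AuxIn q k e ∧ m = ((∏ i, p i ^ e i : ℕ) : ℤ) := by
  classical
  have hcycprod : ∀ {x y z : Fin (k + 2)}, AuxCyc k x y z → ∀ e : Fin (k + 2) → ℕ,
      ((∏ i, p i ^ e i : ℕ) : ℤ) = (p x : ℤ) ^ e x * (p y : ℤ) ^ e y * (p z : ℤ) ^ e z *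
        ∏ i ∈ Finset.univ.filter (fun i : Fin (k + 2) => 3 ≤ (i : ℕ)), (p i : ℤ) ^ e i := by
    intro x y z hc e
    obtain ⟨hxy, hyz, hxz, hx3, hy3, hz3, hall⟩ := hc.props hk
    push_cast
    rw [← Finset.prod_filter_mul_prod_filter_not Finset.univ (fun i : Fin (k + 2) => 3 ≤ (i : ℕ)),
      mul_comm]
    congr 1
    have : Finset.univ.filter (fun i : Fin (k + 2) => ¬ 3 ≤ (i : ℕ)) = {x, y, z} := by
      ext i
      simp only [Finset.mem_filter, Finset.mem_univ, true_and, Finset.mem_insert,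
        Finset.mem_singleton]
      constructor
      · intro h; exact hall i (by omega)
      · rintro (rfl | rfl | rfl) <;> omega
    rw [this, Finset.prod_insert (by simp [hxy, hxz]), Finset.prod_insert (by simp [hyz]),
      Finset.prod_singleton, mul_assoc]
  have htri : ∀ {x y z : Fin (k + 2)}, AuxCyc k x y z →
      ((∃ s ∈ Q0 q, ∃ α : Fin (k + 2) → ℕ, (∀ i, α i ≤ q - 1) ∧
        m = (p y : ℤ) * (p z : ℤ) ^ (q - ZMod.val s) *
        ∏ i ∈ Finset.univ.filter (fun i : Fin (k + 2) => 3 ≤ (i : ℕ)), (p i : ℤ) ^ α i) ↔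
      ∃ e, AuxTri q k x y z e ∧ m = ((∏ i, p i ^ e i : ℕ) : ℤ)) := by
    intro x y z hc
    obtain ⟨hxy, hyz, hxz, hx3, hy3, hz3, hall⟩ := hc.props hk
    constructor
    · rintro ⟨s, hs, α, hα, rfl⟩
      have hge : ∀ i : Fin (k + 2), 3 ≤ (i : ℕ) → i ≠ x ∧ i ≠ y ∧ i ≠ z := by
        intro i hi
        refine ⟨?_, ?_, ?_⟩ <;> rintro rfl <;> omega
      refine ⟨fun i => if i = x then 0 else if i = y then 1 else if i = z then q - s.val else α i,
        ⟨by simp, by simp [hxy.symm], ⟨s, hs, by simp [hxz.symm, hyz.symm]⟩, fun i hi => ?_⟩, ?_⟩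
      · obtain ⟨h1, h2, h3⟩ := hge i hi
        simp only [h1, h2, h3, if_false]
        exact hα i
      · rw [hcycprod hc]
        simp only [if_true, hxy.symm, hxz.symm, hyz.symm, if_false, pow_zero, pow_one, one_mul]
        congr 1
        refine Finset.prod_congr rfl fun i hi => ?_
        obtain ⟨h1, h2, h3⟩ := hge i (Finset.mem_filter.1 hi).2
        simp only [h1, h2, h3, if_false]
    · rintro ⟨e, ⟨h1, h2, ⟨s, hs, h3⟩, h4⟩, rfl⟩
      refine ⟨s, hs, fun i => if 3 ≤ (i : ℕ) then e i else 0, fun i => ?_, ?_⟩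
      · show (if 3 ≤ (i : ℕ) then e i else 0) ≤ q - 1
        split_ifs with h
        · exact h4 i h
        · exact Nat.zero_le _
      · rw [hcycprod hc, h1, h2, h3, pow_zero, pow_one, one_mul]
        congr 1
        refine Finset.prod_congr rfl fun i hi => ?_
        simp only [(Finset.mem_filter.1 hi).2, if_true]
  have hD : ∀ j : Fin (k + 2), 3 ≤ (j : ℕ) → ((∃ α : Fin (k + 2) → ℕ, (∀ i, α i ≤ q - 1) ∧
      m = (p j : ℤ) *
        ∏ i ∈ Finset.univ.filter (fun i : Fin (k + 2) => (j : ℕ) < (i : ℕ)), (p i : ℤ) ^ α i) ↔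
      ∃ e, AuxD q k j e ∧ m = ((∏ i, p i ^ e i : ℕ) : ℤ)) := by
    intro j hj
    have hprod : ∀ e : Fin (k + 2) → ℕ, e j = 1 → (∀ i, i < j → e i = 0) →
        ((∏ i, p i ^ e i : ℕ) : ℤ) = (p j : ℤ) *
        ∏ i ∈ Finset.univ.filter (fun i : Fin (k + 2) => (j : ℕ) < (i : ℕ)), (p i : ℤ) ^ e i := by
      intro e h1 h2
      push_cast
      rw [← Finset.prod_filter_mul_prod_filter_not Finset.univ
        (fun i : Fin (k + 2) => (j : ℕ) < (i : ℕ)), mul_comm]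
      congr 1
      rw [Finset.prod_eq_single j]
      · rw [h1, pow_one]
      · intro i hi hij
        have := (Finset.mem_filter.1 hi).2
        rw [h2 i, pow_zero]
        rw [Fin.lt_def]
        have : (i : ℕ) ≠ j := fun h => hij (Fin.ext h)
        omega
      · intro h; simp at h
    constructor
    · rintro ⟨α, hα, rfl⟩
      refine ⟨fun i => if j < i then α i else if i = j then 1 else 0, ⟨by simp, ?_, ?_⟩, ?_⟩
      · intro i hi
        simp [hi.not_gt, hi.ne]
      · intro i hi
        simp [hi, hα i]
      · rw [hprod _ (by simp) (by intro i hi; simp [hi.not_gt, hi.ne])]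
        congr 1
        refine Finset.prod_congr rfl fun i hi => ?_
        have : j < i := (Finset.mem_filter.1 hi).2
        simp [this]
    · rintro ⟨e, ⟨h1, h2, h3⟩, rfl⟩
      refine ⟨fun i => if j < i then e i else 0, fun i => ?_, ?_⟩
      · show (if j < i then e i else 0) ≤ q - 1
        split_ifs with h
        · exact h3 i h
        · exact Nat.zero_le _
      · rw [hprod e h1 h2]
        congr 1
        refine Finset.prod_congr rfl fun i hi => ?_
        have : j < i := (Finset.mem_filter.1 hi).2
        simp only [this, if_true]
  have hA : AuxCyc k 0 1 2 := Or.inl ⟨rfl, rfl, rfl⟩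
  unfold secondSet
  simp only [Set.mem_union, Set.mem_ofPred_eq]
  have hB := htri hA.rot
  simp only [mul_comm (p 2 : ℤ) ((p 0 : ℤ) ^ _)] at hB
  rw [htri hA, hB, htri hA.rot.rot]
  constructor
  · rintro (((⟨e, h, rfl⟩ | ⟨e, h, rfl⟩) | ⟨e, h, rfl⟩) | ⟨j, hj, h⟩)
    · exact ⟨e, Or.inl ⟨_, _, _, hA, h⟩, rfl⟩
    · exact ⟨e, Or.inl ⟨_, _, _, hA.rot, h⟩, rfl⟩
    · exact ⟨e, Or.inl ⟨_, _, _, hA.rot.rot, h⟩, rfl⟩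
    · obtain ⟨e, h', hm⟩ := (hD j hj).1 h
      exact ⟨e, Or.inr ⟨j, hj, h'⟩, hm⟩
  · rintro ⟨e, ⟨x, y, z, hc, h⟩ | ⟨j, hj, h⟩, hm⟩
    · rcases hc with ⟨rfl, rfl, rfl⟩ | ⟨rfl, rfl, rfl⟩ | ⟨rfl, rfl, rfl⟩
      · exact Or.inl (Or.inl (Or.inl ⟨e, h, hm⟩))
      · exact Or.inl (Or.inl (Or.inr ⟨e, h, hm⟩))
      · exact Or.inl (Or.inr ⟨e, h, hm⟩)
    · exact Or.inr ⟨j, hj, (hD j hj).2 ⟨e, h, hm⟩⟩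

theorem aux_not_pow {q k : ℕ} (hq : q.Prime) (p : Fin (k + 2) → ℕ)
    (hp : ∀ i, (p i).Prime) (hinj : Function.Injective p) (e : Fin (k + 2) → ℕ)
    (he : AuxIn q k e) : ¬ IsPerfectPow q ((∏ i, p i ^ e i : ℕ) : ℤ) := by
  rintro ⟨r, hr⟩
  obtain ⟨i, hi⟩ := aux_has_one he
  have h1 := congrArg Int.natAbs hr
  rw [Int.natAbs_pow, Int.natAbs_natCast] at h1
  have h2 := congrArg (fun n => n.factorization (p i)) h1
  simp only [Nat.factorization_pow, Finsupp.smul_apply, smul_eq_mul] at h2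
  rw [aux_prodval p hp hinj, hi] at h2
  exact hq.one_lt.ne' (Nat.dvd_one.1 ⟨_, h2.symm⟩)

/-- discrete logarithms modulo a prime -/
theorem aux_dlog {n : ℕ} (q l : ℕ) (hl : l.Prime) (p : Fin n → ℕ) (hlp : ∀ i, ¬ l ∣ p i) :
    ∃ a : Fin n → ZMod q, ∀ v : Fin n → ℕ, ∑ i, a i * (v i : ZMod q) = 0 →
      ∃ x : ℤ, (l : ℤ) ∣ x ^ q - ((∏ i, p i ^ v i : ℕ) : ℤ) := by
  have := Fact.mk hl
  obtain ⟨g, hg⟩ := IsCyclic.exists_monoid_generator (α := (ZMod l)ˣ)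
  have h1 : ∀ i, ∃ m : ℕ, (g : ZMod l) ^ m = (p i : ZMod l) := by
    intro i
    have h0 : (p i : ZMod l) ≠ 0 := by
      rw [Ne, ZMod.natCast_eq_zero_iff]; exact hlp i
    obtain ⟨m, hm⟩ := Submonoid.mem_powers_iff _ _ |>.1 (hg (Units.mk0 _ h0))
    refine ⟨m, ?_⟩
    rw [← Units.val_pow_eq_pow_val, hm]; rfl
  choose m hm using h1
  refine ⟨fun i => (m i : ZMod q), fun v hv => ?_⟩
  have h2 : ((∑ i, m i * v i : ℕ) : ZMod q) = 0 := by push_cast; exact hv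
  rw [ZMod.natCast_eq_zero_iff] at h2
  obtain ⟨t, ht⟩ := h2
  refine ⟨(((g : ZMod l) ^ t).val : ℤ), ?_⟩
  rw [← ZMod.intCast_zmod_eq_zero_iff_dvd]
  push_cast
  rw [ZMod.natCast_zmod_val, sub_eq_zero, ← pow_mul, mul_comm, ← ht, ← Finset.prod_pow_eq_pow_sum]
  refine Finset.prod_congr rfl fun i _ => ?_
  rw [pow_mul, hm]

/-- lifting to composite moduli -/
theorem aux_lift (q : ℕ) (M : ℕ) (N : ℕ) (hN : 0 < N) (hNq : Nat.Coprime N q)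
    (hNM : Nat.Coprime N M)
    (h : ∀ l : ℕ, l.Prime → l ∣ N → ∃ x : ℤ, (l : ℤ) ∣ x ^ q - (M : ℤ)) :
    ∃ x : ℤ, (N : ℤ) ∣ x ^ q - (M : ℤ) := by
  induction N using Nat.recOnPosPrimePosCoprime with
  | prime_pow l n hl hn =>
    obtain ⟨x, hx⟩ := h l hl (dvd_pow_self l hn.ne')
    obtain ⟨e, rfl⟩ : ∃ e, n = e + 1 := ⟨n - 1, by omega⟩
    have h1 := dvd_sub_pow_of_dvd_sub (R := ℤ) hx e
    have hlq : Nat.Coprime (l ^ e) q := by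
      refine Nat.Coprime.pow_left _ ?_
      exact Nat.Coprime.coprime_dvd_left (dvd_pow_self l hn.ne') hNq
    have hb : IsCoprime ((l ^ e : ℕ) : ℤ) (q : ℤ) := Nat.isCoprime_iff_coprime.2 hlq
    obtain ⟨u, v, huv⟩ := hb
    have h2 : ((x : ZMod (l ^ (e + 1))) ^ q) ^ (l ^ e) = (M : ZMod (l ^ (e + 1))) ^ (l ^ e) := by
      have : ((l ^ (e + 1) : ℕ) : ℤ) ∣ (x ^ q) ^ l ^ e - (M : ℤ) ^ l ^ e := by
        push_cast; exact h1
      rw [← ZMod.intCast_zmod_eq_zero_iff_dvd] at this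
      push_cast at this
      exact sub_eq_zero.1 this
    have hMu : IsUnit (M : ZMod (l ^ (e + 1))) :=
      (ZMod.isUnit_iff_coprime M _).2 hNM.symm
    by_cases hq0 : q = 0
    · subst hq0
      have h3 : l ^ (e + 1) = 1 := by simpa using hNq
      exact ⟨0, by rw [h3]; simp⟩
    have hxu : IsUnit (x : ZMod (l ^ (e + 1))) := by
      have : IsUnit (((x : ZMod (l ^ (e + 1))) ^ q) ^ (l ^ e)) := by rw [h2]; exact hMu.pow _
      exact (isUnit_pow_iff hq0).1 ((isUnit_pow_iff (pow_ne_zero _ hl.ne_zero)).1 this)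
    obtain ⟨X, hX⟩ := hxu
    obtain ⟨Y, hY⟩ := hMu
    have h3 : (X ^ q) ^ (l ^ e) = Y ^ (l ^ e) := by
      ext
      push_cast
      rw [hX, hY]; exact h2
    have h4 : ((X ^ (l ^ e)) ^ u * Y ^ v) ^ q = Y := by
      rw [mul_pow]
      have h5 : ((X ^ (l ^ e)) ^ u) ^ q = (Y ^ (l ^ e)) ^ u := by
        rw [← h3, ← zpow_natCast, ← zpow_mul, mul_comm u, zpow_mul, zpow_natCast, ← pow_mul,
          mul_comm, pow_mul]
      rw [h5, ← zpow_natCast Y, ← zpow_mul, ← zpow_natCast (Y ^ v), ← zpow_mul, ← zpow_add,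
        mul_comm _ u, huv, zpow_one]
    have : NeZero (l ^ (e + 1)) := ⟨pow_ne_zero _ hl.ne_zero⟩
    refine ⟨((((X ^ (l ^ e)) ^ u * Y ^ v : (ZMod (l ^ (e + 1)))ˣ) : ZMod (l ^ (e + 1))).val : ℤ), ?_⟩
    rw [← ZMod.intCast_zmod_eq_zero_iff_dvd]
    push_cast
    rw [ZMod.natCast_zmod_val, sub_eq_zero, ← hY]
    have h6 := congrArg (Units.val) h4
    push_cast at h6
    exact h6
  | zero => omega
  | one => exact ⟨0, by simp⟩
  | coprime a b ha hb hab iha ihb =>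
    obtain ⟨x, hx⟩ := iha (by omega) (Nat.Coprime.coprime_mul_right hNq)
      (Nat.Coprime.coprime_mul_right hNM) (fun l hl hla => h l hl (hla.mul_right b))
    obtain ⟨y, hy⟩ := ihb (by omega) (Nat.Coprime.coprime_mul_left hNq)
      (Nat.Coprime.coprime_mul_left hNM) (fun l hl hla => h l hl (hla.mul_left a))
    have hc : IsCoprime (a : ℤ) (b : ℤ) := Nat.isCoprime_iff_coprime.2 hab
    obtain ⟨u, v, huv⟩ := id hc
    refine ⟨x * (v * b) + y * (u * a), ?_⟩
    push_cast
    refine hc.mul_dvd ?_ ?_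
    · have h1 : (a : ℤ) ∣ (x * (v * b) + y * (u * a)) - x :=
        ⟨u * (y - x), by linear_combination x * huv⟩
      have h2 := h1.trans (sub_dvd_pow_sub_pow _ _ q)
      have := dvd_add h2 hx
      rwa [sub_add_sub_cancel] at this
    · have h1 : (b : ℤ) ∣ (x * (v * b) + y * (u * a)) - y :=
        ⟨v * (x - y), by linear_combination y * huv⟩
      have h2 := h1.trans (sub_dvd_pow_sub_pow _ _ q)
      have := dvd_add h2 hy
      rwa [sub_add_sub_cancel] at this

theorem aux_memT {q k : ℕ} (hq : q.Prime) (hodd : Odd q) (hk : 2 ≤ k)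
    (p : Fin (k + 2) → ℕ) (hp : ∀ i, (p i).Prime) : MemT q k (secondSet q k p) := by
  classical
  have := Fact.mk hq
  refine ⟨q * ∏ i, p i, Nat.mul_pos hq.pos (Finset.prod_pos fun i _ => (hp i).pos), ?_⟩
  intro N hN hlen hcop
  have hNq : Nat.Coprime N q := Nat.Coprime.coprime_mul_right_right hcop
  have hNp : ∀ i, Nat.Coprime N (p i) := fun i =>
    Nat.Coprime.coprime_dvd_right (Finset.dvd_prod_of_mem p (Finset.mem_univ i))
      (Nat.Coprime.coprime_mul_left_right hcop)
  have hdl : ∀ l : ℕ, ∃ a : Fin (k + 2) → ZMod q, l ∈ N.primeFactors → ∀ v : Fin (k + 2) → ℕ,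
      ∑ i, a i * (v i : ZMod q) = 0 →
      ∃ x : ℤ, (l : ℤ) ∣ x ^ q - ((∏ i, p i ^ v i : ℕ) : ℤ) := by
    intro l
    by_cases hl : l ∈ N.primeFactors
    · obtain ⟨a, ha⟩ := aux_dlog q l (Nat.prime_of_mem_primeFactors hl) p (by
        intro i hi
        have h1 := Nat.dvd_gcd (Nat.dvd_of_mem_primeFactors hl) hi
        rw [hNp i] at h1
        exact (Nat.prime_of_mem_primeFactors hl).one_lt.ne' (Nat.dvd_one.1 h1))
      exact ⟨a, fun _ => ha⟩
    · exact ⟨0, fun h => (hl h).elim⟩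
  choose a ha using hdl
  have hcard : N.primeFactors.card ≤ k := by
    refine le_trans ?_ hlen
    exact List.toFinset_card_le _
  let W : Submodule (ZMod q) (Fin (k + 2) → ZMod q) :=
    { carrier := {w | ∀ l ∈ N.primeFactors, ∑ i, a l i * w i = 0}
      zero_mem' := by intro l _; simp
      add_mem' := by
        intro v w hv hw l hl
        simp only [Pi.add_apply, mul_add, Finset.sum_add_distrib]
        rw [hv l hl, hw l hl, add_zero]
      smul_mem' := by
        intro r w hw l hl
        simp only [Pi.smul_apply, smul_eq_mul, mul_left_comm _ r, ← Finset.mul_sum]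
        rw [hw l hl, mul_zero] }
  obtain ⟨e, he, heW⟩ := aux_blocking hq hodd hk W (fun x => by
    obtain ⟨w, h1, h2, h3⟩ := aux_common hq N.primeFactors (n := k + 2) (by omega) a x
    exact ⟨w, h1, h2, h3⟩)
  refine ⟨((∏ i, p i ^ e i : ℕ) : ℤ), (aux_second hk p _).2 ⟨e, he, rfl⟩, ?_⟩
  refine aux_lift q _ N hN hNq ?_ ?_
  · exact Nat.Coprime.prod_right fun i _ => Nat.Coprime.pow_right _ (hNp i)
  · intro l hl hlN
    have hlm : l ∈ N.primeFactors := Nat.mem_primeFactors.2 ⟨hl, hlN, hN.ne'⟩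
    exact ha l hlm e (heW l hlm)

end Final

section Minimal

theorem aux_ind {q k : ℕ} (e₀ w : Fin (k + 2) → ℕ) (y i : Fin (k + 2)) :
    ∑ j, (Pi.single (M := fun _ => ZMod q) i (1 : ZMod q) -
      (e₀ i : ZMod q) • Pi.single (M := fun _ => ZMod q) y (1 : ZMod q)) j * (w j : ZMod q) =
      (w i : ZMod q) - e₀ i * w y := by
  classical
  simp [sub_mul, Finset.sum_sub_distrib, Pi.single_apply]

theorem aux_exists_nonsq {q : ℕ} (hq : q.Prime) (hodd : Odd q) :
    ∃ η : ZMod q, ¬ IsSquare η := by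
  have := Fact.mk hq
  apply FiniteField.exists_nonsquare
  rw [ZMod.ringChar_zmod_n]
  rintro rfl
  exact absurd hodd (by decide)

theorem aux_card_ge {k : ℕ} (hk : 2 ≤ k) :
    (Finset.univ.filter (fun i : Fin (k + 2) => 3 ≤ (i : ℕ))).card = k - 1 := by
  have : Finset.univ.filter (fun i : Fin (k + 2) => 3 ≤ (i : ℕ)) =
      Finset.Ioi (⟨2, by omega⟩ : Fin (k + 2)) := by
    ext i
    simp [Fin.lt_def, Nat.succ_le_iff]
  rw [this, Fin.card_Ioi]
  simp only
  omega

theorem aux_functionals {q k : ℕ} (hq : q.Prime) (hodd : Odd q) (hk : 2 ≤ k)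
    (e₀ : Fin (k + 2) → ℕ) (he₀ : AuxIn q k e₀) :
    ∃ (I : Finset (Fin (k + 2))) (c : Fin (k + 2) → Fin (k + 2) → ZMod q), I.card ≤ k ∧
      ∀ e, AuxIn q k e → (∀ i ∈ I, ∑ j, c i j * (e j : ZMod q) = 0) → e = e₀ := by
  classical
  have := Fact.mk hq
  rcases id he₀ with ⟨x, y, z, hc, h1, h2, ⟨s, hs, h3⟩, h4⟩ | ⟨j, hj, h1, h2, h3⟩
  · obtain ⟨hxy, hyz, hxz, hx3, hy3, hz3, hall⟩ := hc.props hk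
    obtain ⟨η, hη⟩ := aux_exists_nonsq hq hodd
    let c : Fin (k + 2) → Fin (k + 2) → ZMod q := fun i =>
      if i = x then η • Pi.single x 1 + s • Pi.single y 1 + Pi.single z 1
      else Pi.single i 1 - (e₀ i : ZMod q) • Pi.single y 1
    refine ⟨insert x (Finset.univ.filter (fun i : Fin (k + 2) => 3 ≤ (i : ℕ))), c, ?_, ?_⟩
    · refine (Finset.card_insert_le _ _).trans ?_
      rw [aux_card_ge hk]
      omega
    · intro e he hkill
      have hk1 : η * (e x : ZMod q) + s * e y + e z = 0 := by
        have := hkill x (Finset.mem_insert_self _ _)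
        simpa [c, add_mul, Finset.sum_add_distrib, Pi.single_apply, mul_assoc] using this
      have hk2 : ∀ i : Fin (k + 2), 3 ≤ (i : ℕ) → (e i : ZMod q) = e₀ i * e y := by
        intro i hi
        have h5 := hkill i (Finset.mem_insert_of_mem (by simp [hi]))
        have hix : i ≠ x := by rintro rfl; omega
        simp only [c, hix, if_false] at h5
        rw [aux_ind] at h5
        exact sub_eq_zero.1 h5
      rw [aux_Q0] at hs
      rcases id he with ⟨x', y', z', hc', h1', h2', ⟨s', hs', h3'⟩, h4'⟩ | ⟨j', hj', h1', h2', h3'⟩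
      · rw [aux_Q0] at hs'
        rcases hc.cases hk hc' with ⟨rfl, rfl, rfl⟩ | ⟨rfl, rfl, rfl⟩ | ⟨rfl, rfl, rfl⟩
        · apply aux_unique hq hk he he₀
          intro i
          by_cases hi : 3 ≤ (i : ℕ)
          · rw [hk2 i hi, h2']; simp
          · rcases hall i (by omega) with rfl | rfl | rfl
            · rw [h1, h1']
            · rw [h2, h2']
            · rw [h1', h2', h3', aux_neg_cast] at hk1
              rw [h3, h3', aux_neg_cast, aux_neg_cast]
              push_cast at hk1
              linear_combination hk1
        · exfalso
          rw [h1', h2', h3', aux_neg_cast] at hk1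
          push_cast at hk1
          have h6 : η * s' = 1 := by linear_combination -hk1
          apply hη
          have : η = s'⁻¹ := eq_inv_of_mul_eq_one_left h6
          rw [this]
          exact hs'.inv
        · exfalso
          rw [h1', h2', h3', aux_neg_cast] at hk1
          push_cast at hk1
          apply hη
          have : η = s * s' := by linear_combination hk1
          rw [this]
          exact hs.mul hs'
      · exfalso
        have h5 := hk2 j' hj'
        rw [h1', h2' y (aux_fin_ge hj' hy3)] at h5
        simp at h5
  · obtain ⟨v0, v1, v2⟩ := aux_vals hk
    let c : Fin (k + 2) → Fin (k + 2) → ZMod q := fun i =>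
      if i = 1 then Pi.single 0 1 - Pi.single 1 1
      else if i = 2 then Pi.single 1 1 - Pi.single 2 1
      else Pi.single i 1 - (e₀ i : ZMod q) • Pi.single j 1
    have hj0 : j ≠ 0 := by rintro rfl; omega
    have hj1 : j ≠ 1 := by rintro rfl; omega
    have hj2 : j ≠ 2 := by rintro rfl; omega
    have h10 : (1 : Fin (k + 2)) ≠ 0 := by rw [Ne, Fin.ext_iff]; omega
    have h20 : (2 : Fin (k + 2)) ≠ 0 := by rw [Ne, Fin.ext_iff]; omega
    have h21 : (2 : Fin (k + 2)) ≠ 1 := by rw [Ne, Fin.ext_iff]; omega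
    refine ⟨(Finset.univ.erase 0).erase j, c, ?_, ?_⟩
    · rw [Finset.card_erase_of_mem (by simp [hj0]), Finset.card_erase_of_mem (by simp)]
      simp
    · intro e he hkill
      have hk1 : (e 0 : ZMod q) = e 1 := by
        have h5 := hkill 1 (by simp [hj1.symm, h10])
        simp [c, sub_mul, Finset.sum_sub_distrib, Pi.single_apply] at h5
        exact sub_eq_zero.1 h5
      have hk2 : (e 1 : ZMod q) = e 2 := by
        have h5 := hkill 2 (by simp [hj2.symm, h20])
        simp [c, h21, sub_mul, Finset.sum_sub_distrib, Pi.single_apply] at h5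
        exact sub_eq_zero.1 h5
      have hk3 : ∀ i : Fin (k + 2), 3 ≤ (i : ℕ) → i ≠ j → (e i : ZMod q) = e₀ i * e j := by
        intro i hi hij
        have hi0 : i ≠ 0 := by rintro rfl; omega
        have hi1 : i ≠ 1 := by rintro rfl; omega
        have hi2 : i ≠ 2 := by rintro rfl; omega
        have h5 := hkill i (by simp [hij, hi0])
        simp only [c, hi1, hi2, if_false] at h5
        rw [aux_ind] at h5
        exact sub_eq_zero.1 h5
      rcases id he with ⟨x', y', z', hc', h1', h2', ⟨s', hs', h3'⟩, h4'⟩ | ⟨j', hj', h1', h2', h3'⟩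
      · exfalso
        have hxy : (e x' : ZMod q) = e y' := by
          rcases hc' with ⟨rfl, rfl, rfl⟩ | ⟨rfl, rfl, rfl⟩ | ⟨rfl, rfl, rfl⟩
          · exact hk1
          · exact hk2
          · exact (hk1.trans hk2).symm
        rw [h1', h2'] at hxy
        simp at hxy
      · have hjj : j' = j := by
          by_contra hne
          have h5 := hk3 j' hj' hne
          rw [h1'] at h5
          rcases lt_or_gt_of_ne hne with h | h
          · rw [h2 j' h] at h5; simp at h5
          · rw [h2' j h] at h5; simp at h5
        subst hjj
        apply aux_unique hq hk he he₀
        intro i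
        by_cases hij : i = j'
        · rw [hij, h1, h1']
        by_cases hi : 3 ≤ (i : ℕ)
        · rw [hk3 i hi hij, h1']; simp
        · rw [h2 i (aux_fin_ge hj (by omega)), h2' i (aux_fin_ge hj (by omega))]

theorem aux_Omega_prod {ι : Type*} (I : Finset ι) (l : ι → ℕ) (hl : ∀ i ∈ I, (l i).Prime) :
    (∏ i ∈ I, l i).primeFactorsList.length = I.card := by
  classical
  induction I using Finset.induction_on with
  | empty => simp
  | insert a s ha ih =>
    rw [Finset.prod_insert ha, Finset.card_insert_of_notMem ha]
    have h1 : l a ≠ 0 := (hl a (Finset.mem_insert_self _ _)).ne_zero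
    have h2 : ∏ i ∈ s, l i ≠ 0 := Finset.prod_ne_zero_iff.2 fun i hi =>
      (hl i (Finset.mem_insert_of_mem hi)).ne_zero
    rw [(Nat.perm_primeFactorsList_mul h1 h2).length_eq, List.length_append,
      ih (fun i hi => hl i (Finset.mem_insert_of_mem hi)),
      Nat.primeFactorsList_prime (hl a (Finset.mem_insert_self _ _))]
    simp [add_comm]

theorem aux_minimal {q k : ℕ} (hq : q.Prime) (hodd : Odd q) (hk : 2 ≤ k)
    (p : Fin (k + 2) → ℕ) (hp : ∀ i, (p i).Prime) (hinj : Function.Injective p)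
    (T : Set ℤ) (hT : T ⊂ secondSet q k p) : ¬ MemT q k T := by
  rintro ⟨Δ, hΔ, hmem⟩
  obtain ⟨m, hm, hmT⟩ := Set.exists_of_ssubset hT
  obtain ⟨e₀, he₀, rfl⟩ := (aux_second hk p m).1 hm
  obtain ⟨I, c, hI, hc⟩ := aux_functionals hq hodd hk e₀ he₀
  have hch := fun i => aux_cheb q hq p hp hinj (c i) Δ hΔ
  choose l hl hlΔ hlc using hch
  obtain ⟨t, ht, x, hx⟩ := hmem (∏ i ∈ I, l i) (Finset.prod_pos fun i _ => (hl i).pos)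
    (by rw [aux_Omega_prod I l (fun i _ => hl i)]; exact hI)
    (Nat.Coprime.prod_left fun i _ => (Nat.Prime.coprime_iff_not_dvd (hl i)).2 (hlΔ i))
  obtain ⟨e, he, rfl⟩ := (aux_second hk p t).1 (hT.1 ht)
  have : e = e₀ := by
    refine hc e he fun i hi => hlc i e ⟨(x : ZMod (l i)), ?_⟩
    have h1 : ((l i : ℕ) : ℤ) ∣ x ^ q - ((∏ i, p i ^ e i : ℕ) : ℤ) :=
      (Int.natCast_dvd_natCast.2 (Finset.dvd_prod_of_mem l hi)).trans hx
    rw [← ZMod.intCast_zmod_eq_zero_iff_dvd] at h1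
    rw [Int.cast_sub, Int.cast_pow, Int.cast_natCast] at h1
    exact sub_eq_zero.1 h1
  rw [this] at ht
  exact hmT ht

end Minimal

section Card

theorem aux_card_Q0 {q : ℕ} (hq : q.Prime) (hodd : Odd q) :
    ∃ F : Finset ℕ, F.card = (q + 1) / 2 ∧ ∀ m, m ∈ F ↔ ∃ s ∈ Q0 q, m = q - ZMod.val s := by
  classical
  have := Fact.mk hq
  have hq2 : q % 2 = 1 := Nat.odd_iff.1 hodd
  refine ⟨(Finset.range (q / 2 + 1)).image (fun i : ℕ => q - ((i : ZMod q) ^ 2).val), ?_, ?_⟩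
  · rw [Finset.card_image_of_injOn, Finset.card_range]
    · omega
    · intro i hi j hj hij
      simp only [Finset.coe_range, Set.mem_Iio] at hi hj
      have h1 := ZMod.val_lt ((i : ZMod q) ^ 2)
      have h2 := ZMod.val_lt ((j : ZMod q) ^ 2)
      have h3 : ((i : ZMod q) ^ 2).val = ((j : ZMod q) ^ 2).val := by
        simp only at hij
        omega
      have h4 := ZMod.val_injective q h3
      rcases sq_eq_sq_iff_eq_or_eq_neg.1 h4 with h | h
      · exact aux_le_eq hq.pos (by omega) (by omega) h
      · have h5 : ((i + j : ℕ) : ZMod q) = 0 := by push_cast; rw [h]; ring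
        rw [ZMod.natCast_eq_zero_iff] at h5
        have := Nat.eq_zero_of_dvd_of_lt h5 (by omega)
        omega
  · intro m
    simp only [Finset.mem_image, Finset.mem_range]
    constructor
    · rintro ⟨i, _, rfl⟩
      exact ⟨(i : ZMod q) ^ 2, (aux_Q0 q _).2 ⟨i, sq _⟩, rfl⟩
    · rintro ⟨s, hs, rfl⟩
      obtain ⟨a, rfl⟩ := (aux_Q0 q s).1 hs
      refine ⟨a.valMinAbs.natAbs, ?_, ?_⟩
      · have := ZMod.natAbs_valMinAbs_le a
        omega
      · have : ((a.valMinAbs.natAbs : ℕ) : ZMod q) ^ 2 = a * a := by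
          have h1 : (((a.valMinAbs.natAbs : ℤ) ^ 2 : ℤ) : ZMod q) =
              ((a.valMinAbs ^ 2 : ℤ) : ZMod q) := by
            rw [Int.natAbs_sq]
          rw [Int.cast_pow, Int.cast_pow, ZMod.coe_valMinAbs, Int.cast_natCast] at h1
          rw [← sq]
          exact h1
        rw [this]

theorem aux_card {q k : ℕ} (hq : q.Prime) (hodd : Odd q) (hk : 2 ≤ k)
    (p : Fin (k + 2) → ℕ) (hp : ∀ i, (p i).Prime) (hinj : Function.Injective p) :
    (secondSet q k p).ncard =
        (∑ i ∈ Finset.range (k + 1), q ^ i) + q ^ (k - 1) * ((q + 1) / 2) := by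
  classical
  obtain ⟨F, hF, hFm⟩ := aux_card_Q0 hq hodd
  obtain ⟨v0, v1, v2⟩ := aux_vals hk
  -- the triangle pieces
  let P : Fin (k + 2) → Fin (k + 2) → Fin (k + 2) → Finset (Fin (k + 2) → ℕ) := fun x y z =>
    Fintype.piFinset (fun i => if i = x then {0} else if i = y then {1} else if i = z then F
      else Finset.range q)
  have hPm : ∀ {x y z}, AuxCyc k x y z → ∀ e, e ∈ P x y z ↔ AuxTri q k x y z e := by
    intro x y z hc e
    obtain ⟨hxy, hyz, hxz, hx3, hy3, hz3, hall⟩ := hc.props hk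
    simp only [P, Fintype.mem_piFinset]
    constructor
    · intro h
      refine ⟨by simpa using h x, by simpa [hxy.symm] using h y,
        (hFm _).1 (by simpa [hxz.symm, hyz.symm] using h z), fun i hi => ?_⟩
      have hix : i ≠ x := by rintro rfl; omega
      have hiy : i ≠ y := by rintro rfl; omega
      have hiz : i ≠ z := by rintro rfl; omega
      have := h i
      simp only [hix, hiy, hiz, if_false, Finset.mem_range] at this
      omega
    · rintro ⟨h1, h2, h3, h4⟩ i
      by_cases hi : 3 ≤ (i : ℕ)
      · have hix : i ≠ x := by rintro rfl; omega
        have hiy : i ≠ y := by rintro rfl; omega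
        have hiz : i ≠ z := by rintro rfl; omega
        simp only [hix, hiy, hiz, if_false, Finset.mem_range]
        have := h4 i hi
        have := hq.pos
        omega
      · rcases hall i (by omega) with rfl | rfl | rfl
        · simp [h1]
        · simp [hxy.symm, h2]
        · simp only [hxz.symm, hyz.symm, if_false, if_true]
          exact (hFm _).2 h3
  have hPc : ∀ {x y z}, AuxCyc k x y z → (P x y z).card = (q + 1) / 2 * q ^ (k - 1) := by
    intro x y z hc
    obtain ⟨hxy, hyz, hxz, hx3, hy3, hz3, hall⟩ := hc.props hk
    simp only [P, Fintype.card_piFinset]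
    rw [← Finset.prod_filter_mul_prod_filter_not Finset.univ
      (fun i : Fin (k + 2) => 3 ≤ (i : ℕ)), mul_comm]
    have : Finset.univ.filter (fun i : Fin (k + 2) => ¬ 3 ≤ (i : ℕ)) = {x, y, z} := by
      ext i
      simp only [Finset.mem_filter, Finset.mem_univ, true_and, Finset.mem_insert,
        Finset.mem_singleton]
      constructor
      · intro h; exact hall i (by omega)
      · rintro (rfl | rfl | rfl) <;> omega
    rw [this, Finset.prod_insert (by simp [hxy, hxz]), Finset.prod_insert (by simp [hyz]),
      Finset.prod_singleton]
    congr 1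
    · simp [hxy.symm, hxz.symm, hyz.symm, hF]
    · rw [← aux_card_ge hk]
      refine Finset.prod_eq_pow_card fun i hi => ?_
      have hi := (Finset.mem_filter.1 hi).2
      have hix : i ≠ x := by rintro rfl; omega
      have hiy : i ≠ y := by rintro rfl; omega
      have hiz : i ≠ z := by rintro rfl; omega
      simp [hix, hiy, hiz]
  -- the D pieces
  let G : Fin (k + 2) → Finset (Fin (k + 2) → ℕ) := fun j =>
    Fintype.piFinset (fun i => if j < i then Finset.range q else if i = j then {1} else {0})
  have hGm : ∀ j e, e ∈ G j ↔ AuxD q k j e := by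
    intro j e
    simp only [G, Fintype.mem_piFinset]
    constructor
    · intro h
      refine ⟨by simpa using h j, fun i hi => by simpa [hi.not_gt, hi.ne] using h i, fun i hi => ?_⟩
      have := h i
      simp only [hi, if_true, Finset.mem_range] at this
      omega
    · rintro ⟨h1, h2, h3⟩ i
      rcases lt_trichotomy i j with hi | rfl | hi
      · simp [hi.not_gt, hi.ne, h2 i hi]
      · simp [h1]
      · simp only [hi, if_true, Finset.mem_range]
        have := h3 i hi
        have := hq.pos
        omega
  have hGc : ∀ j, (G j).card = q ^ (k + 1 - (j : ℕ)) := by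
    intro j
    simp only [G, Fintype.card_piFinset]
    have : ∀ i : Fin (k + 2), (if j < i then Finset.range q else if i = j then {1} else {0}).card =
        if j < i then q else 1 := by
      intro i; split_ifs <;> simp
    rw [Finset.prod_congr rfl (fun i _ => this i), Finset.prod_ite, Finset.prod_const,
      Finset.prod_const_one, mul_one]
    congr 1
    have : Finset.univ.filter (fun i : Fin (k + 2) => j < i) = Finset.Ioi j := by ext; simp
    rw [this, Fin.card_Ioi]
    omega
  let J : Finset (Fin (k + 2)) := Finset.univ.filter (fun i : Fin (k + 2) => 3 ≤ (i : ℕ))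
  let U : Finset (Fin (k + 2) → ℕ) := ((P 0 1 2 ∪ P 1 2 0) ∪ P 2 0 1) ∪ J.biUnion G
  have hA : AuxCyc k 0 1 2 := Or.inl ⟨rfl, rfl, rfl⟩
  have hU : ∀ e, e ∈ U ↔ AuxIn q k e := by
    intro e
    simp only [U, J, Finset.mem_union, Finset.mem_biUnion, Finset.mem_filter, Finset.mem_univ,
      true_and, hPm hA, hPm hA.rot, hPm hA.rot.rot, hGm]
    constructor
    · rintro (((h | h) | h) | h)
      · exact Or.inl ⟨_, _, _, hA, h⟩
      · exact Or.inl ⟨_, _, _, hA.rot, h⟩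
      · exact Or.inl ⟨_, _, _, hA.rot.rot, h⟩
      · exact Or.inr h
    · rintro (⟨x, y, z, hc, h⟩ | h)
      · rcases hc with ⟨rfl, rfl, rfl⟩ | ⟨rfl, rfl, rfl⟩ | ⟨rfl, rfl, rfl⟩
        · exact Or.inl (Or.inl (Or.inl h))
        · exact Or.inl (Or.inl (Or.inr h))
        · exact Or.inl (Or.inr h)
      · exact Or.inr h
  have hS : secondSet q k p = (fun e : Fin (k + 2) → ℕ => ((∏ i, p i ^ e i : ℕ) : ℤ)) '' (U : Set _) := by
    ext m
    rw [aux_second hk p m, Set.mem_image]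
    constructor
    · rintro ⟨e, he, rfl⟩
      exact ⟨e, (hU e).2 he, rfl⟩
    · rintro ⟨e, he, rfl⟩
      exact ⟨e, (hU e).1 he, rfl⟩
  rw [hS, Set.ncard_image_of_injective, Set.ncard_coe_finset]
  · -- the count
    have hdis : ∀ {x y z}, AuxCyc k x y z → Disjoint (P x y z) (P y z x) := by
      intro x y z hc
      rw [Finset.disjoint_left]
      intro e h1 h2
      rw [hPm hc] at h1
      rw [hPm hc.rot] at h2
      have := h1.2.1
      rw [h2.1] at this
      exact absurd this (by omega)
    have hdisD : ∀ {x y z}, AuxCyc k x y z → Disjoint (P x y z) (J.biUnion G) := by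
      intro x y z hc
      rw [Finset.disjoint_left]
      intro e h1 h2
      rw [hPm hc] at h1
      simp only [Finset.mem_biUnion, J, Finset.mem_filter, Finset.mem_univ, true_and, hGm] at h2
      obtain ⟨j, hj, h2⟩ := h2
      have := h1.2.1
      rw [h2.2.1 y (aux_fin_ge hj (hc.props hk).2.2.2.2.1)] at this
      exact absurd this (by omega)
    have hGd : (J.biUnion G).card = ∑ t ∈ Finset.range (k - 1), q ^ t := by
      rw [Finset.card_biUnion]
      · simp only [hGc]
        refine Finset.sum_nbij' (fun j : Fin (k + 2) => k + 1 - (j : ℕ))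
          (fun t => (⟨k + 1 - t, by omega⟩ : Fin (k + 2))) ?_ ?_ ?_ ?_ ?_
        · intro j hj
          have := (Finset.mem_filter.1 hj).2
          rw [Finset.mem_range]; omega
        · intro t ht
          rw [Finset.mem_range] at ht
          simp only [J, Finset.mem_filter, Finset.mem_univ, true_and]; omega
        · intro j hj
          apply Fin.ext
          have := j.2
          simp only; omega
        · intro t ht
          rw [Finset.mem_range] at ht
          simp only; omega
        · intro j _; rfl
      · intro j _ j' _ hne
        rw [Function.onFun, Finset.disjoint_left]
        intro e h1 h2
        rw [hGm] at h1 h2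
        rcases lt_or_gt_of_ne hne with h | h
        · have := h2.2.1 j h
          rw [h1.1] at this; omega
        · have := h1.2.1 j' h
          rw [h2.1] at this; omega
    have hd1 := hdis hA
    have hd2 := hdis hA.rot
    have hd3 := (hdis hA.rot.rot).symm
    simp only [U]
    rw [Finset.card_union_of_disjoint, Finset.card_union_of_disjoint,
      Finset.card_union_of_disjoint hd1, hPc hA, hPc hA.rot, hPc hA.rot.rot, hGd]
    · obtain ⟨k', rfl⟩ : ∃ k', k = k' + 1 := ⟨k - 1, by omega⟩
      rw [Finset.sum_range_succ, Finset.sum_range_succ]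
      have h2a : 2 * ((q + 1) / 2) = q + 1 := by
        have := Nat.odd_iff.1 hodd
        omega
      simp only [Nat.add_sub_cancel]
      rw [pow_succ]
      linear_combination q ^ k' * h2a
    · rw [Finset.disjoint_union_left]
      exact ⟨hd3, hd2⟩
    · rw [Finset.disjoint_union_left, Finset.disjoint_union_left]
      exact ⟨⟨hdisD hA, hdisD hA.rot⟩, hdisD hA.rot.rot⟩
  · intro e e' h
    have h1 : ∏ i, p i ^ e i = ∏ i, p i ^ e' i := Nat.cast_injective (R := ℤ) h
    funext i
    rw [← aux_prodval p hp hinj e i, ← aux_prodval p hp hinj e' i, h1]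

end Card

/-- **Theorem.** For any odd prime `q`, `k ≥ 2` and distinct primes `p_1, …, p_{k+2}`, the set
`secondSet` contains no perfect `q`-th power, belongs to `𝒯_{k,q}`, is minimal in `𝒯_{k,q}`,
and has size `(q^{k+1}-1)/(q-1) + q^{k-1}(q+1)/2`. -/
theorem stmt17 (q k : ℕ) (hq : q.Prime) (hodd : Odd q) (hk : 2 ≤ k)
    (p : Fin (k + 2) → ℕ) (hp : ∀ i, (p i).Prime) (hpinj : Function.Injective p) :
    (∀ m ∈ secondSet q k p, ¬ IsPerfectPow q m) ∧
      MemT q k (secondSet q k p) ∧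
      (∀ T : Set ℤ, T ⊂ secondSet q k p → ¬ MemT q k T) ∧
      (secondSet q k p).ncard =
        (∑ i ∈ Finset.range (k + 1), q ^ i) + q ^ (k - 1) * ((q + 1) / 2) := by
  refine ⟨fun m hm => ?_, aux_memT hq hodd hk p hp,
    fun T hT => aux_minimal hq hodd hk p hp hpinj T hT, aux_card hq hodd hk p hp hpinj⟩
  obtain ⟨e, he, rfl⟩ := (aux_second hk p m).1 hm
  exact aux_not_pow hq p hp hpinj e he
end

section
/- Let q be an odd prime and p any prime. Then there exist infinitely many primes ℓ such that for every j ∈ {1, …, q−1} there is no integer x with x^q ≡ p^j (mod ℓ). In particular, the set {p, p², …, p^{q−1}} does not belong to 𝒯_{1,q}. -/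
open Finset

lemma rat_pow_ne (q p : ℕ) (hq : q.Prime) (hp : p.Prime) (b : ℚ) : b ^ q ≠ p := by
  intro h
  have := Fact.mk hp
  have hb : b ≠ 0 := by
    rintro rfl
    rw [zero_pow hq.ne_zero] at h
    exact hp.ne_zero (by exact_mod_cast h.symm)
  have h1 := congrArg (padicValRat p) h
  rw [padicValRat.pow, padicValRat.of_nat, padicValNat_self] at h1
  have : (q : ℤ) ∣ 1 := ⟨_, by exact_mod_cast h1.symm⟩
  have h2 : q ∣ 1 := by exact_mod_cast this
  exact hq.one_lt.ne' (Nat.dvd_one.mp h2)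

open NumberField Polynomial in
lemma exponent_ne_zero_aux (K : Type) [Field K] [NumberField K] (pb : PowerBasis ℚ K) (θ : 𝓞 K)
    (hθ : (θ : K) = pb.gen) : RingOfIntegers.exponent θ ≠ 0 := by
  have hint : IsIntegral ℤ pb.gen := hθ ▸ θ.2
  have hd0 := Algebra.discr_not_zero_of_basis ℚ pb.basis
  set δ := Algebra.discr ℚ pb.basis with hδ
  have hmem : (δ.num : 𝓞 K) ∈ conductor ℤ θ := by
    rw [mem_conductor_iff]
    intro b
    have h1 : δ • (b : K) ∈ Algebra.adjoin ℤ ({pb.gen} : Set K) :=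
      Algebra.discr_mul_isIntegral_mem_adjoin ℚ hint b.2
    have h2 : (δ.den : ℤ) • (δ • (b : K)) ∈ Algebra.adjoin ℤ ({pb.gen} : Set K) :=
      Subalgebra.smul_mem _ h1 _
    have h3 : (δ.den : ℤ) • (δ • (b : K)) = algebraMap (𝓞 K) K ((δ.num : 𝓞 K) * b) := by
      rw [map_mul, map_intCast, zsmul_eq_mul, Algebra.smul_def, ← mul_assoc]
      congr 1
      have := Rat.den_mul_eq_num δ
      have h4 := congrArg (algebraMap ℚ K) this
      rw [map_mul, map_natCast, map_intCast] at h4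
      rw [← h4, Int.cast_natCast]
    rw [h3] at h2
    have h5 : Algebra.adjoin ℤ ({pb.gen} : Set K) =
        (Algebra.adjoin ℤ ({θ} : Set (𝓞 K))).map ((Algebra.ofId (𝓞 K) K).restrictScalars ℤ) := by
      rw [AlgHom.map_adjoin, Set.image_singleton, ← hθ]
      rfl
    rw [h5] at h2
    obtain ⟨y, hy, hy2⟩ := h2
    have : y = (δ.num : 𝓞 K) * b := RingOfIntegers.coe_injective hy2
    exact this ▸ hy
  intro h0
  rw [RingOfIntegers.exponent, Ideal.absNorm_eq_zero_iff] at h0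
  have : δ.num ∈ Ideal.under ℤ (conductor ℤ θ) := by
    rw [Ideal.under_def, Ideal.mem_comap]
    simpa using hmem
  rw [h0, Ideal.mem_bot] at this
  exact hd0 (Rat.num_eq_zero.mp this)

open NumberField Polynomial in
lemma lemA (q p : ℕ) (hq : q.Prime) (hp : p.Prime) :
    ∃ (K : Type) (_ : Field K) (_ : NumberField K) (d : ℕ), 0 < d ∧
      ∀ l : ℕ, l.Prime → ¬ l ∣ d → ∃ P : ZMod l → Ideal (𝓞 K),
        (∀ r, r ^ q = (p : ZMod l) → Prime (P r) ∧ Ideal.absNorm (P r) = l) ∧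
        (∀ r r', r ^ q = (p : ZMod l) → r' ^ q = (p : ZMod l) → P r = P r' → r = r') := by
  have hirr : Irreducible (X ^ q - C (p : ℚ)) :=
    X_pow_sub_C_irreducible_of_prime hq (rat_pow_ne q p hq hp)
  have : Fact (Irreducible (X ^ q - C (p : ℚ))) := ⟨hirr⟩
  let K := AdjoinRoot (X ^ q - C (p : ℚ))
  let pb : PowerBasis ℚ K := AdjoinRoot.powerBasis hirr.ne_zero
  have : FiniteDimensional ℚ K := pb.finite
  have : CharZero K := charZero_of_injective_algebraMap (algebraMap ℚ K).injective
  have : NumberField K := { to_charZero := inferInstance, to_finiteDimensional := inferInstance }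
  have hroot : (pb.gen : K) ^ q = (p : K) := by
    have h := AdjoinRoot.eval₂_root (X ^ q - C (p : ℚ))
    simp only [eval₂_sub, eval₂_X_pow, eval₂_C, sub_eq_zero] at h
    simpa [pb] using h
  have hmon : (X ^ q - C (p : ℤ)).Monic := monic_X_pow_sub_C _ hq.ne_zero
  have hint : IsIntegral ℤ pb.gen := ⟨X ^ q - C (p : ℤ), hmon, by simp [hroot]⟩
  let θ : 𝓞 K := ⟨pb.gen, hint⟩
  have hmin : minpoly ℤ θ = X ^ q - C (p : ℤ) := by
    have h1 := minpoly.isIntegrallyClosed_eq_field_fractions ℚ K (RingOfIntegers.isIntegral θ)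
    have h2 : minpoly ℚ (algebraMap (𝓞 K) K θ) = X ^ q - C (p : ℚ) := by
      symm
      apply minpoly.eq_of_irreducible_of_monic hirr
      · have : algebraMap (𝓞 K) K θ = pb.gen := rfl
        rw [this]
        simp [hroot]
      · exact monic_X_pow_sub_C _ hq.ne_zero
    apply Polynomial.map_injective (algebraMap ℤ ℚ) (algebraMap ℤ ℚ).injective_int
    rw [← h1, h2]
    simp
  refine ⟨K, inferInstance, inferInstance, RingOfIntegers.exponent θ,
    Nat.pos_of_ne_zero (exponent_ne_zero_aux K pb θ rfl), ?_⟩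
  intro l hl hld
  have := Fact.mk hl
  have hex : ∀ r : ZMod l, r ^ q = (p : ZMod l) → ∃ φ : 𝓞 K →+* ZMod l, φ θ = r := by
    intro r hr
    let e := RingOfIntegers.ZModXQuotSpanEquivQuotSpan hld
    let ev : (ZMod l)[X] ⧸ Ideal.span {map (Int.castRingHom (ZMod l)) (minpoly ℤ θ)} →+* ZMod l :=
      Ideal.Quotient.lift _ (evalRingHom r) (by
        intro a ha
        rw [Ideal.mem_span_singleton] at ha
        obtain ⟨c, rfl⟩ := ha
        rw [map_mul]
        have : evalRingHom r (map (Int.castRingHom (ZMod l)) (minpoly ℤ θ)) = 0 := by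
          rw [hmin]; simp [hr]
        rw [this, zero_mul])
    refine ⟨ev.comp (e.symm.toRingHom.comp (Ideal.Quotient.mk _)), ?_⟩
    have h1 := RingOfIntegers.ZModXQuotSpanEquivQuotSpan_mk_apply hld (X : ℤ[X])
    rw [aeval_X] at h1
    simp only [RingHom.comp_apply]
    rw [← h1]
    change ev (e.symm (e _)) = r
    rw [RingEquiv.symm_apply_apply]
    simp [ev]
  classical
  refine ⟨fun r => if h : r ^ q = (p : ZMod l) then RingHom.ker (hex r h).choose else ⊥, ?_, ?_⟩
  · intro r hr
    simp only [dif_pos hr]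
    set φ := (hex r hr).choose
    have hsurj : Function.Surjective φ := ZMod.ringHom_surjective φ
    have hnorm : Ideal.absNorm (RingHom.ker φ) = l := by
      rw [Ideal.absNorm_apply, Submodule.cardQuot_apply]
      have := Nat.card_congr (RingHom.quotientKerEquivOfSurjective hsurj).toEquiv
      rw [Nat.card_zmod] at this
      exact this
    refine ⟨?_, hnorm⟩
    apply Ideal.prime_of_isPrime
    · intro h
      rw [h, Ideal.absNorm_bot] at hnorm
      exact hl.ne_zero hnorm.symm
    · exact RingHom.ker_isPrime φ
  · intro r r' hr hr' h
    simp only [dif_pos hr, dif_pos hr'] at h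
    have h1 := (hex r hr).choose_spec
    have h2 := (hex r' hr').choose_spec
    set φ := (hex r hr).choose
    set φ' := (hex r' hr').choose
    obtain ⟨n, hn⟩ := ZMod.intCast_surjective r
    have h3 : θ - (n : 𝓞 K) ∈ RingHom.ker φ := by
      rw [RingHom.mem_ker, map_sub, h1, map_intCast, hn, sub_self]
    rw [h, RingHom.mem_ker, map_sub, h2, map_intCast, hn, sub_eq_zero] at h3
    exact h3.symm

open NumberField in
lemma prime_eq_of_dvd {K : Type*} [Field K] [NumberField K] {I J : Ideal (𝓞 K)}
    (hI : Prime I) (hJ : Prime J) (h : I ∣ J) : I = J :=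
  associated_iff_eq.mp (hI.associated_of_dvd hJ h)

open NumberField in
lemma lemB (K : Type*) [Field K] [NumberField K] (B : ℕ) (hB : 0 < B)
    (P Q : ℕ → Ideal (𝓞 K)) (T : Set ℕ)
    (hP : ∀ l, l.Prime → ¬ l ∣ B → Prime (P l) ∧ Ideal.absNorm (P l) = l)
    (hT : ∀ l ∈ T, l.Prime ∧ ¬ l ∣ B)
    (hQ : ∀ l ∈ T, Prime (Q l) ∧ Ideal.absNorm (Q l) = l ∧ Q l ≠ P l) :
    ∃ M : ℝ, ∀ T0 : Finset ℕ, (↑T0 ⊆ T) → ∑ l ∈ T0, (1 : ℝ) / l ≤ M := by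
  classical
  have hlim := NumberField.Ideal.tendsto_norm_le_div_atTop K
  set κ := ((2 ^ InfinitePlace.nrRealPlaces K * (2 * Real.pi) ^ InfinitePlace.nrComplexPlaces K * Units.regulator K * classNumber K) /
        (Units.torsionOrder K * Real.sqrt |discr K|)) with hκ
  refine ⟨2 * B * (κ + 1), fun T0 hT0 => ?_⟩
  have hlim' := (hlim.comp tendsto_natCast_atTop_atTop).eventually (gt_mem_nhds (lt_add_one κ))
  obtain ⟨s, hs1, hs2, hs3⟩ := (hlim'.and ((Filter.eventually_ge_atTop (2 * ∑ l ∈ T0, l)).and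
    (Filter.eventually_gt_atTop 0))).exists
  simp only [Function.comp_apply] at hs1
  have hs0 : (0 : ℝ) < s := by exact_mod_cast hs3
  rw [div_lt_iff₀ hs0] at hs1
  let J : ℕ → Ideal (𝓞 K) := fun n => (n.primeFactorsList.map P).prod
  have hJ : ∀ n, n ≠ 0 → n.Coprime B → Ideal.absNorm (J n) = n := by
    intro n hn hc
    simp only [J]
    rw [map_list_prod, List.map_map]
    conv_rhs => rw [← Nat.prod_primeFactorsList hn]
    congr 1
    conv_rhs => rw [← List.map_id n.primeFactorsList]
    apply List.map_congr_left
    intro l hl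
    have hl' := Nat.prime_of_mem_primeFactorsList hl
    simp only [Function.comp_apply, id]
    refine (hP l hl' fun h => ?_).2
    exact Nat.not_coprime_of_dvd_of_dvd hl'.one_lt (Nat.dvd_of_mem_primeFactorsList hl) h hc
  have hcop : ∀ m, (B * m + 1).Coprime B := fun m => by simp
  let A : Finset (Σ _ : ℕ, ℕ) := T0.sigma fun l => range (s / (2 * B * l) + 1)
  have hfin : Finite {I : Ideal (𝓞 K) // (Ideal.absNorm I : ℝ) ≤ s} := by
    have := Ideal.finite_setOfPred_absNorm_le (S := 𝓞 K) s
    simp only [Nat.cast_le]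
    exact this.to_subtype
  have hmem : ∀ x ∈ A, (Ideal.absNorm (J (B * x.2 + 1) * Q x.1) : ℝ) ≤ s := by
    rintro ⟨l, m⟩ hx
    simp only [A, Finset.mem_sigma, Finset.mem_range] at hx
    obtain ⟨hl, hm⟩ := hx
    have hlT := hT0 hl
    rw [map_mul, hJ _ (by omega) (hcop m), (hQ l hlT).2.1]
    norm_cast
    have h1 : m ≤ s / (2 * B * l) := by omega
    have hl0 := (hT l hlT).1.pos
    rw [Nat.le_div_iff_mul_le (by positivity)] at h1
    have h2 : l ≤ ∑ l ∈ T0, l := Finset.single_le_sum (f := fun l => l) (fun _ _ => Nat.zero_le _) hl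
    nlinarith
  let F : A → {I : Ideal (𝓞 K) // (Ideal.absNorm I : ℝ) ≤ s} := fun x => ⟨_, hmem x.1 x.2⟩
  have hF : Function.Injective F := by
    rintro ⟨⟨l, m⟩, hx⟩ ⟨⟨l', m'⟩, hx'⟩ heq
    simp only [F, Subtype.mk.injEq] at heq
    simp only [A, Finset.mem_sigma, Finset.mem_range] at hx hx'
    have hlT := hT0 hx.1
    have hlT' := hT0 hx'.1
    have hll : l = l' := by
      have hd : Q l ∣ J (B * m' + 1) * Q l' := heq ▸ dvd_mul_left _ _
      rcases (hQ l hlT).1.dvd_or_dvd hd with h | h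
      · exfalso
        obtain ⟨I, hI, hd2⟩ := (hQ l hlT).1.dvd_prod_iff.mp h
        obtain ⟨r, hr, rfl⟩ := List.mem_map.mp hI
        have hr' := Nat.prime_of_mem_primeFactorsList hr
        have hrB : ¬ r ∣ B := fun h =>
          Nat.not_coprime_of_dvd_of_dvd hr'.one_lt (Nat.dvd_of_mem_primeFactorsList hr) h (hcop m')
        have he := prime_eq_of_dvd (hQ l hlT).1 (hP r hr' hrB).1 hd2
        have : l = r := by rw [← (hQ l hlT).2.1, he, (hP r hr' hrB).2]
        subst this
        exact (hQ l hlT).2.2 he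
      · have he := prime_eq_of_dvd (hQ l hlT).1 (hQ l' hlT').1 h
        rw [← (hQ l hlT).2.1, he, (hQ l' hlT').2.1]
    subst hll
    have hn := congrArg Ideal.absNorm heq
    rw [map_mul, map_mul, hJ _ (by omega) (hcop m), hJ _ (by omega) (hcop m'), (hQ l hlT).2.1] at hn
    have h3 := Nat.eq_of_mul_eq_mul_right (hT l hlT).1.pos hn
    have h4 : B * m = B * m' := by omega
    have h5 := Nat.eq_of_mul_eq_mul_left hB h4
    subst h5
    rfl
  have hcard := Nat.card_le_card_of_injective F hF
  rw [Nat.card_eq_fintype_card, Fintype.card_coe, Finset.card_sigma] at hcard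
  simp only [card_range] at hcard
  have hcard' : ∑ l ∈ T0, ((s / (2 * B * l) + 1 : ℕ) : ℝ) ≤
    (Nat.card {I : Ideal (𝓞 K) // (Ideal.absNorm I : ℝ) ≤ s} : ℝ) := by exact_mod_cast hcard
  have h6 : ∑ l ∈ T0, (s / (2 * B) : ℝ) * (1 / l) ≤ ∑ l ∈ T0, ((s / (2 * B * l) + 1 : ℕ) : ℝ) := by
    apply Finset.sum_le_sum
    intro l hl
    have hl0 : (0:ℝ) < l := by exact_mod_cast (hT l (hT0 hl)).1.pos
    have hB0 : (0:ℝ) < B := by exact_mod_cast hB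
    have := (Nat.lt_floor_add_one ((s : ℝ) / ((2 * B * l : ℕ) : ℝ)))
    rw [Nat.floor_div_eq_div] at this
    push_cast at this ⊢
    calc (s / (2 * B) : ℝ) * (1 / l) = (s:ℝ) / (2 * B * l) := by field_simp
      _ ≤ _ := this.le
  rw [← Finset.mul_sum] at h6
  have hB0 : (0:ℝ) < B := by exact_mod_cast hB
  have h7 : (s / (2 * B) : ℝ) * ∑ l ∈ T0, (1 / l : ℝ) < (κ + 1) * s := by linarith
  have h8 : (s / (2 * B) : ℝ) * ∑ l ∈ T0, (1 / l : ℝ) < (s / (2 * B) : ℝ) * (2 * B * (κ + 1)) := by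
    calc _ < _ := h7
      _ = _ := by field_simp
  exact (lt_of_mul_lt_mul_left h8 (by positivity)).le

open ArithmeticFunction ArithmeticFunction.vonMangoldt in
lemma lemC (q : ℕ) [NeZero q] {a : ZMod q} (ha : IsUnit a) :
    ¬ Summable (fun n : ℕ => if n.Prime ∧ (n : ZMod q) = a then (1 : ℝ) / n else 0) := by
  intro hS
  obtain ⟨C, hC⟩ := LSeries_residueClass_lower_bound ha
  have hnp := summable_residueClass_non_primes_div a
  set D := ∑' n : ℕ, (if n.Prime then 0 else residueClass a n) / (n : ℝ) with hD
  set c := (q.totient : ℝ)⁻¹ with hc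
  have hcpos : 0 < c := inv_pos.mpr (mod_cast q.totient.pos_of_neZero)
  set M := ∑' n : ℕ, (if n.Prime ∧ (n : ZMod q) = a then (1 : ℝ) / n else 0) with hM
  let h : ℝ → ℕ → ℝ := fun x n => (if n.Prime then residueClass a n else 0) / (n : ℝ) ^ x
  have hsum : ∀ x : ℝ, 1 < x → Summable (fun n : ℕ => residueClass a n / (n : ℝ) ^ x) := fun x hx =>
    LSeries.summable_real_of_abscissaOfAbsConv_lt <|
        (abscissaOfAbsConv_residueClass_le_one a).trans_lt <| mod_cast hx
  have hpow : ∀ x : ℝ, 1 < x → ∀ n : ℕ, (n : ℝ) ≤ (n : ℝ) ^ x := by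
    intro x hx n
    rcases n.eq_zero_or_pos with rfl | hn
    · simp [Real.zero_rpow (by linarith : x ≠ 0)]
    · conv_lhs => rw [← Real.rpow_one n]
      exact Real.rpow_le_rpow_of_exponent_le (by exact_mod_cast hn) hx.le
  have hsumh : ∀ x : ℝ, 1 < x → Summable (h x) := by
    intro x hx
    refine (hsum x hx).of_nonneg_of_le (fun n => ?_) (fun n => ?_)
    · have := residueClass_nonneg a n
      simp only [h]; split_ifs <;> positivity
    · have := residueClass_nonneg a n
      simp only [h]; gcongr; split_ifs <;> simp [this]
  have hlow : ∀ x : ℝ, 1 < x → x ≤ 2 → c / (x - 1) - (C + D) ≤ ∑' n, h x n := by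
    intro x hx hx2
    have h1 := hC (x := x) ⟨hx, hx2⟩
    have h2 : ∑' n, residueClass a n / (n : ℝ) ^ x ≤ ∑' n, (h x n +
        (if n.Prime then 0 else residueClass a n) / (n : ℝ)) := by
      refine Summable.tsum_le_tsum (fun n => ?_) (hsum x hx) ((hsumh x hx).add hnp)
      have := residueClass_nonneg a n
      simp only [h]
      split_ifs with hn
      · simp
      · simp only [zero_div, zero_add]
        rcases n.eq_zero_or_pos with rfl | hn
        · simp
        · exact div_le_div_of_nonneg_left this (by exact_mod_cast hn) (hpow x hx n)
    rw [(hsumh x hx).tsum_add hnp] at h2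
    linarith
  let X : ℕ → ℝ := fun k => 1 + (1/2 : ℝ) ^ k
  have hX1 : ∀ k, 1 < X k := fun k => by simp only [X]; have : (0:ℝ) < (1/2)^k := by positivity
                                         linarith
  have hX2 : ∀ k, X k ≤ 2 := fun k => by
    simp only [X]; have : ((1/2 : ℝ))^k ≤ 1 := pow_le_one₀ (by norm_num) (by norm_num)
    linarith
  have key : ∀ K n : ℕ, ∑ k ∈ range K, (1/2 : ℝ) ^ (k+1) * h (X k) n ≤
      (if n.Prime ∧ (n : ZMod q) = a then (1 : ℝ) / n else 0) := by
    intro K n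
    by_cases hn : n.Prime ∧ (n : ZMod q) = a
    · rw [if_pos hn]
      have hn0 : (0 : ℝ) < n := by exact_mod_cast hn.1.pos
      have hstep : ∀ k, (1/2 : ℝ) ^ (k+1) * h (X k) n ≤
          (n : ℝ) ^ (-X (k+1)) - (n : ℝ) ^ (-X k) := by
        intro k
        have e1 : h (X k) n = Real.log n * (n : ℝ) ^ (-X k) := by
          simp only [h, if_pos hn.1, residueClass]
          rw [Set.indicator_of_mem (by exact hn.2), vonMangoldt_apply_prime hn.1,
            Real.rpow_neg hn0.le, div_eq_mul_inv]
        have e2 : (n : ℝ) ^ (-X (k+1)) = (n : ℝ) ^ (-X k) * (n : ℝ) ^ ((1/2 : ℝ) ^ (k+1)) := by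
          rw [← Real.rpow_add hn0]; congr 1; simp only [X]; ring
        have e3 : 1 + (1/2 : ℝ) ^ (k+1) * Real.log n ≤ (n : ℝ) ^ ((1/2 : ℝ) ^ (k+1)) := by
          rw [Real.rpow_def_of_pos hn0]
          have := Real.add_one_le_exp (Real.log n * (1/2 : ℝ) ^ (k+1))
          linarith
        have e4 : 0 < (n : ℝ) ^ (-X k) := Real.rpow_pos_of_pos hn0 _
        rw [e1, e2]
        nlinarith [mul_le_mul_of_nonneg_left e3 e4.le]
      calc _ ≤ ∑ k ∈ range K, ((n : ℝ) ^ (-X (k+1)) - (n : ℝ) ^ (-X k)) :=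
            Finset.sum_le_sum fun k _ => hstep k
        _ = (n : ℝ) ^ (-X K) - (n : ℝ) ^ (-X 0) := Finset.sum_range_sub (fun k => (n : ℝ) ^ (-X k)) K
        _ ≤ (n : ℝ) ^ (-X K) := by
            have : 0 < (n : ℝ) ^ (-X 0) := Real.rpow_pos_of_pos hn0 _
            linarith
        _ ≤ 1 / n := by
            rw [Real.rpow_neg hn0.le, ← one_div]
            exact one_div_le_one_div_of_le hn0 (hpow _ (hX1 K) n)
    · rw [if_neg hn]
      apply le_of_eq
      apply Finset.sum_eq_zero
      intro k _
      have : h (X k) n = 0 := by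
        simp only [h]
        by_cases hp : n.Prime
        · have : residueClass a n = 0 := by
            simp only [residueClass]
            exact Set.indicator_of_notMem (s := {n : ℕ | (n : ZMod q) = a}) (fun h => hn ⟨hp, h⟩) _
          simp [this]
        · simp [hp]
      rw [this, mul_zero]
  have hbound : ∀ K : ℕ, K * (c / 2) - |C + D| ≤ M := by
    intro K
    have s1 : ∀ k, Summable (fun n => (1/2 : ℝ) ^ (k+1) * h (X k) n) := fun k =>
      (hsumh _ (hX1 k)).mul_left _
    have h1 : ∑' n, ∑ k ∈ range K, (1/2 : ℝ) ^ (k+1) * h (X k) n ≤ M :=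
      Summable.tsum_le_tsum (key K) (summable_sum fun k _ => s1 k) hS
    rw [Summable.tsum_finsetSum (fun k _ => s1 k)] at h1
    have h2 : ∀ k, c / 2 - (1/2 : ℝ) ^ (k+1) * |C + D| ≤ ∑' n, (1/2 : ℝ) ^ (k+1) * h (X k) n := by
      intro k
      rw [tsum_mul_left]
      have h3 := hlow _ (hX1 k) (hX2 k)
      have hp : (0:ℝ) < (1/2 : ℝ) ^ k := by positivity
      have h4 : c / (X k - 1) = c / (1/2 : ℝ)^k := by simp [X]
      rw [h4] at h3
      have h5 : (1/2 : ℝ) ^ (k+1) * (c / (1/2 : ℝ)^k) = c / 2 := by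
        rw [pow_succ]; field_simp
      have h6 := mul_le_mul_of_nonneg_left h3 (by positivity : (0:ℝ) ≤ (1/2 : ℝ) ^ (k+1))
      have h7 := mul_le_mul_of_nonneg_left (le_abs_self (C + D)) (by positivity : (0:ℝ) ≤ (1/2 : ℝ) ^ (k+1))
      rw [mul_sub, h5] at h6
      linarith
    have h8 := (Finset.sum_le_sum fun k (_ : k ∈ range K) => h2 k).trans h1
    rw [Finset.sum_sub_distrib, ← Finset.sum_mul] at h8
    simp only [sum_const, card_range, nsmul_eq_mul] at h8
    have h9 : ∀ K : ℕ, ∑ k ∈ range K, (1/2 : ℝ) ^ (k+1) = 1 - (1/2 : ℝ) ^ K := by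
      intro K
      induction K with
      | zero => simp
      | succ m ih => rw [Finset.sum_range_succ, ih]; ring
    rw [h9] at h8
    have : (0:ℝ) < (1/2 : ℝ) ^ K := by positivity
    nlinarith [abs_nonneg (C + D)]
  obtain ⟨K, hK⟩ := exists_nat_gt ((M + |C + D|) / (c / 2))
  rw [div_lt_iff₀ (by positivity)] at hK
  linarith [hbound K]

lemma root_of_pow (q p l : ℕ) (hq : q.Prime) (hp : p.Prime) (hl : l.Prime) (hlp : ¬ l ∣ p)
    (j : ℕ) (hj1 : 1 ≤ j) (hj2 : j ≤ q - 1) (x : ℤ) (hx : (l : ℤ) ∣ x ^ q - (p : ℤ) ^ j) :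
    ∃ r : ZMod l, r ^ q = (p : ZMod l) := by
  have := Fact.mk hl
  have hp0 : (p : ZMod l) ≠ 0 := by
    rwa [Ne, ZMod.natCast_eq_zero_iff]
  have h1 : (x : ZMod l) ^ q = (p : ZMod l) ^ j := by
    have := (ZMod.intCast_zmod_eq_zero_iff_dvd _ l).mpr hx
    push_cast at this
    exact sub_eq_zero.mp this
  have hco : Nat.Coprime j q := by
    rw [Nat.coprime_comm, hq.coprime_iff_not_dvd]
    intro h
    have := Nat.le_of_dvd hj1 h
    have := hq.pos
    omega
  obtain ⟨a, ha⟩ := Nat.exists_mul_mod_eq_one_of_coprime hco hq.one_lt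
  have h2 : j * a = q * (j * a / q) + 1 := by
    conv_lhs => rw [← Nat.div_add_mod (j * a) q, ha.2]
  refine ⟨(x : ZMod l) ^ a / (p : ZMod l) ^ (j * a / q), ?_⟩
  rw [div_pow, div_eq_iff (by positivity), ← pow_mul, mul_comm a q, pow_mul, h1, ← pow_mul, h2,
    ← pow_mul, pow_succ]
  rw [mul_comm, ← h2, mul_comm (j * a / q) q]

lemma exists_zeta (q l : ℕ) (hq : q.Prime) (hl : l.Prime) (h : (l : ZMod q) = 1) :
    ∃ z : ZMod l, z ^ q = 1 ∧ z ≠ 1 := by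
  have := Fact.mk hl
  have := Fact.mk hq
  have hd : q ∣ Nat.card (ZMod l)ˣ := by
    rw [Nat.card_eq_fintype_card, ZMod.card_units]
    rw [← ZMod.natCast_eq_zero_iff, Nat.cast_sub hl.one_lt.le, h]; simp
  obtain ⟨u, hu⟩ := exists_prime_orderOf_dvd_card' q hd
  refine ⟨u, ?_, ?_⟩
  · have := pow_orderOf_eq_one u
    rw [hu] at this
    rw [← Units.val_pow_eq_pow_val, this, Units.val_one]
  · intro h1
    have : u = 1 := Units.ext h1
    rw [this, orderOf_one] at hu
    exact hq.one_lt.ne hu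

lemma infinite_part (q p : ℕ) (hq : q.Prime) (hp : p.Prime) :
    {ℓ : ℕ | ℓ.Prime ∧ ∀ j : ℕ, 1 ≤ j → j ≤ q - 1 →
        ¬ ∃ x : ℤ, (ℓ : ℤ) ∣ x ^ q - (p : ℤ) ^ j}.Infinite := by
  intro hfin
  classical
  have := NeZero.mk hq.ne_zero
  set E := hfin.toFinset with hE
  obtain ⟨K, _, _, d, hd, hA⟩ := lemA q p hq hp
  let B := d * p * ∏ l ∈ E, l
  have hB : 0 < B := by
    refine Nat.mul_pos (Nat.mul_pos hd hp.pos) (Finset.prod_pos fun l hl => ?_)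
    rw [hE, Set.Finite.mem_toFinset] at hl
    exact hl.1.pos
  have hroot : ∀ l : ℕ, l.Prime → ¬ l ∣ B → ∃ r : ZMod l, r ^ q = (p : ZMod l) := by
    intro l hl hlB
    have hlE : l ∉ E := fun h => hlB ((Finset.dvd_prod_of_mem _ h).mul_left _)
    rw [hE, Set.Finite.mem_toFinset] at hlE
    have : ∃ j : ℕ, 1 ≤ j ∧ j ≤ q - 1 ∧ ∃ x : ℤ, (l : ℤ) ∣ x ^ q - (p : ℤ) ^ j := by
      by_contra hcon
      exact hlE ⟨hl, fun j h1 h2 h3 => hcon ⟨j, h1, h2, h3⟩⟩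
    obtain ⟨j, h1, h2, x, hx⟩ := this
    exact root_of_pow q p l hq hp hl (fun h => hlB ((h.mul_left _).mul_right _)) j h1 h2 x hx
  have hAB : ∀ l : ℕ, l.Prime → ¬ l ∣ B → ¬ l ∣ d := fun l _ h1 h2 =>
    h1 ((h2.mul_right _).mul_right _)
  have hPex : ∀ l : ℕ, ∃ I : Ideal (NumberField.RingOfIntegers K) × Ideal (NumberField.RingOfIntegers K),
      l.Prime → ¬ l ∣ B → (Prime I.1 ∧ Ideal.absNorm I.1 = l) ∧
        ((l : ZMod q) = 1 → Prime I.2 ∧ Ideal.absNorm I.2 = l ∧ I.2 ≠ I.1) := by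
    intro l
    by_cases h : l.Prime ∧ ¬ l ∣ B
    · obtain ⟨hl, hlB⟩ := h
      have := Fact.mk hl
      obtain ⟨r, hr⟩ := hroot l hl hlB
      obtain ⟨P, hP1, hP2⟩ := hA l hl (hAB l hl hlB)
      by_cases h1 : (l : ZMod q) = 1
      · obtain ⟨z, hz, hz1⟩ := exists_zeta q l hq hl h1
        have hrz : (r * z) ^ q = (p : ZMod l) := by rw [mul_pow, hz, mul_one, hr]
        refine ⟨(P r, P (r * z)), fun _ _ => ⟨hP1 r hr, fun _ => ⟨(hP1 _ hrz).1, (hP1 _ hrz).2, ?_⟩⟩⟩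
        intro he
        have h2 := hP2 _ _ hrz hr he
        have hr0 : r ≠ 0 := by
          rintro rfl
          rw [zero_pow hq.ne_zero] at hr
          have h3 := (ZMod.natCast_eq_zero_iff p l).mp hr.symm
          exact hlB ((h3.mul_left _).mul_right _)
        exact hz1 (mul_left_cancel₀ hr0 (h2.trans (mul_one r).symm))
      · exact ⟨(P r, P r), fun _ _ => ⟨hP1 r hr, fun h => absurd h h1⟩⟩
    · exact ⟨(⊥, ⊥), fun h1 h2 => absurd ⟨h1, h2⟩ h⟩
  choose I hI using hPex
  obtain ⟨M, hM⟩ := lemB K B hB (fun l => (I l).1) (fun l => (I l).2)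
    {l | l.Prime ∧ ¬ l ∣ B ∧ (l : ZMod q) = 1}
    (fun l h1 h2 => (hI l h1 h2).1) (fun l h => ⟨h.1, h.2.1⟩)
    (fun l h => (hI l h.1 h.2.1).2 h.2.2)
  apply lemC q (a := (1 : ZMod q)) isUnit_one
  refine summable_of_sum_le (c := M + ∑ l ∈ B.divisors, (1 : ℝ) / l) (fun n => ?_) (fun u => ?_)
  · show (0 : ℝ) ≤ _
    split_ifs <;> positivity
  · rw [← Finset.sum_filter]
    rw [← Finset.sum_filter_add_sum_filter_not _ (fun l => ¬ l ∣ B)]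
    apply add_le_add
    · apply hM
      intro l hl
      simp only [Finset.coe_filter, Finset.mem_filter, Set.mem_ofPred_eq] at hl
      exact ⟨hl.1.2.1, hl.2, hl.1.2.2⟩
    · apply Finset.sum_le_sum_of_subset_of_nonneg
      · intro l hl
        simp only [Finset.mem_filter, not_not] at hl
        exact Nat.mem_divisors.mpr ⟨hl.2, hB.ne'⟩
      · intros; positivity

/-- **Base case.** For any prime `p`, there are infinitely many primes `ℓ` modulo which no
`p^j` (`1 ≤ j ≤ q-1`) is a `q`-th power; in particular
`{p, p^2, …, p^{q-1}} ∉ 𝒯_{1,q}`. -/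
theorem stmt18 (q p : ℕ) (hq : q.Prime) (hodd : Odd q) (hp : p.Prime) :
    {ℓ : ℕ | ℓ.Prime ∧ ∀ j : ℕ, 1 ≤ j → j ≤ q - 1 →
        ¬ ∃ x : ℤ, (ℓ : ℤ) ∣ x ^ q - (p : ℤ) ^ j}.Infinite ∧
      ¬ MemT q 1 {m : ℤ | ∃ j : ℕ, 1 ≤ j ∧ j ≤ q - 1 ∧ m = (p : ℤ) ^ j} := by
  refine ⟨infinite_part q p hq hp, ?_⟩
  rintro ⟨D, hD, h⟩
  obtain ⟨l, ⟨hl, hl2⟩, hlD⟩ := (infinite_part q p hq hp).exists_gt D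
  obtain ⟨s, ⟨j, h1, h2, rfl⟩, x, hx⟩ := h l hl.pos
    (by rw [Nat.primeFactorsList_prime hl]; simp)
    (hl.coprime_iff_not_dvd.mpr fun hd => absurd (Nat.le_of_dvd hD hd) (by omega))
  exact hl2 j h1 h2 ⟨x, hx⟩
end
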